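/- arXiv:1809.04743 — 2 statements merged into one kernel-verified Lean document; each statement's English description precedes it below -/
import Mathlib

section
/- Let 0 < α ≤ 2, β ≥ 0, and γ > β + 1/2. Let A be injective and generate a tempered (α,β)-ROF R_{α,β;A}. Then A^{-1} generates a tempered (α,γ)-ROF given by R_{α,γ;A^{-1}}(t)x = t^γ/Γ(γ+1) · x - t^{(1+β+γ)/2} ∫₀^∞ J_{1+β+γ}(2√(st)) s^{-(1+β+γ)/2} R_{α,β;A}(s)x ds for all x ∈ X, t > 0; in particular ‖R_{α,γ;A^{-1}}(t)‖ ≤ M' t^γ and ∫₀^∞ e^{-λt} R_{α,γ;A^{-1}}(t)x dt = λ^{α-γ-1}(λ^α - A^{-1})^{-1}x for Re λ > 0. -/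
open MeasureTheory Set

/-- The Wright function `φ(ρ, μ; z) = ∑ z^k/(k! Γ(ρk+μ))`. -/
noncomputable def wright (ρ : ℝ) (μ : ℂ) (z : ℂ) : ℂ :=
  ∑' k : ℕ, z ^ k / ((k.factorial : ℂ) * Complex.Gamma ((ρ : ℂ) * k + μ))

/-- Bessel function of the first kind of real order `ν` at a real argument. -/
noncomputable def besselJ (ν : ℝ) (x : ℝ) : ℝ :=
  (x / 2) ^ ν * ∑' k : ℕ, (-1 : ℝ) ^ k * (x / 2) ^ (2 * k) /
    ((k.factorial : ℝ) * Real.Gamma (ν + k + 1))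

/-- Mittag-Leffler function. -/
noncomputable def mittagLeffler (a m : ℝ) (z : ℂ) : ℂ :=
  ∑' k : ℕ, z ^ k / Complex.Gamma ((a : ℂ) * k + m)

variable {X : Type*} [NormedAddCommGroup X] [NormedSpace ℂ X]

/-- `R` is the (bounded, everywhere-defined) resolvent `(z - A)⁻¹` of the
(possibly unbounded) linear operator `A`; i.e. `z ∈ ρ(A)`. -/
structure IsResolventOf (A : X →ₗ.[ℂ] X) (z : ℂ) (R : X →L[ℂ] X) : Prop where
  mem : ∀ x : X, R x ∈ A.domain
  right : ∀ x : X, z • R x - A ⟨R x, mem x⟩ = x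
  left : ∀ y : A.domain, R (z • (y : X) - A y) = y

/-- The open sector of half-angle `θ` around the positive real axis. -/
def sect (θ : ℝ) : Set ℂ := {z : ℂ | z ≠ 0 ∧ |Complex.arg z| < θ}

/-- `A` is sectorial of angle `ω`: the spectrum lies in the closed sector of angle `ω`
(resolvents exist outside) and `‖z(z-A)⁻¹‖` is uniformly bounded outside each bigger
closed sector. -/
def IsSectorial (A : X →ₗ.[ℂ] X) (ω : ℝ) : Prop :=
  (∀ z ∈ (closure (sect ω))ᶜ, ∃ R : X →L[ℂ] X, IsResolventOf A z R) ∧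
  ∀ ω' ∈ Set.Ioo ω Real.pi, ∃ M : ℝ,
    ∀ z ∈ (closure (sect ω'))ᶜ, ∀ R : X →L[ℂ] X, IsResolventOf A z R → ‖z‖ * ‖R‖ ≤ M

/-- `B = A⁻¹` as an unbounded operator. -/
def IsInverseOf (B A : X →ₗ.[ℂ] X) : Prop :=
  (∀ x : A.domain, ∃ h : A x ∈ B.domain, B ⟨A x, h⟩ = (x : X)) ∧
  (∀ y : B.domain, ∃ h : B y ∈ A.domain, A ⟨B y, h⟩ = (y : X))

/-- Riemann–Liouville fractional integral of order `μ > 0`. -/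
noncomputable def fracInt (μ : ℝ) (f : ℝ → X) (t : ℝ) : X :=
  ∫ s in Set.Ioo 0 t, ((t - s) ^ (μ - 1) / Real.Gamma μ) • f s

/-- `S` is a `β`-times integrated `α`-resolvent operator function generated by `A`,
with exponential bound `M e^{ω t}`. -/
structure IsROF (A : X →ₗ.[ℂ] X) (α β : ℝ) (S : ℝ → X →L[ℂ] X) (ω M : ℝ) : Prop where
  cont : ∀ x : X, ContinuousOn (fun t : ℝ => S t x) (Set.Ici 0)
  bound : ∀ t : ℝ, 0 ≤ t → ‖S t‖ ≤ M * Real.exp (ω * t)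
  laplace : ∀ l : ℝ, ω < l → ∃ R : X →L[ℂ] X,
    IsResolventOf A ((l ^ α : ℝ) : ℂ) R ∧
    ∀ x : X, ((l ^ (α - β - 1) : ℝ) : ℂ) • R x =
      ∫ t in Set.Ioi (0 : ℝ), Real.exp (-(l * t)) • S t x

/-- `S` is a tempered `β`-times integrated `α`-resolvent operator function generated
by `A`: `‖S t‖ ≤ M t^β` and the Laplace-transform identity holds for all `λ > 0`. -/
structure IsTemperedROF (A : X →ₗ.[ℂ] X) (α β : ℝ) (S : ℝ → X →L[ℂ] X) (M : ℝ) : Prop where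
  cont : ∀ x : X, ContinuousOn (fun t : ℝ => S t x) (Set.Ici 0)
  bound : ∀ t : ℝ, 0 ≤ t → ‖S t‖ ≤ M * t ^ β
  laplace : ∀ l : ℝ, 0 < l → ∃ R : X →L[ℂ] X,
    IsResolventOf A ((l ^ α : ℝ) : ℂ) R ∧
    ∀ x : X, ((l ^ (α - β - 1) : ℝ) : ℂ) • R x =
      ∫ t in Set.Ioi (0 : ℝ), Real.exp (-(l * t)) • S t x


/-- The Bessel–Clifford function `∑ (-z)^k / (k! Γ(ν + k + 1))`, which satisfies
`J_ν(x) = (x / 2)^ν * besselClifford ν (x² / 4)`. -/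
noncomputable def besselClifford (ν z : ℝ) : ℝ :=
  ∑' k : ℕ, (-1 : ℝ) ^ k * z ^ k / ((k.factorial : ℝ) * Real.Gamma (ν + k + 1))

theorem Gamma_le_Gamma_add_nat {ν : ℝ} (hν : 0 ≤ ν) (k : ℕ) :
    Real.Gamma (ν + 1) ≤ Real.Gamma (ν + k + 1) := by
  induction k with
  | zero => simp
  | succ k ih =>
    refine ih.trans ?_
    have h : Real.Gamma (ν + (k + 1 : ℕ) + 1) = (ν + k + 1) * Real.Gamma (ν + k + 1) := by
      rw [← Real.Gamma_add_one (by positivity)]; push_cast; ring_nf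
    rw [h]
    have h1 : 0 < Real.Gamma (ν + k + 1) := Real.Gamma_pos_of_pos (by positivity)
    have h2 : 0 ≤ ν + k := by positivity
    nlinarith

theorem besselClifford_term_norm_le {ν : ℝ} (hν : 0 ≤ ν) {z r : ℝ} (hz : |z| ≤ r) (k : ℕ) :
    ‖(-1 : ℝ) ^ k * z ^ k / ((k.factorial : ℝ) * Real.Gamma (ν + k + 1))‖ ≤
      r ^ k / k.factorial * (Real.Gamma (ν + 1))⁻¹ := by
  have h1 : 0 < Real.Gamma (ν + 1) := Real.Gamma_pos_of_pos (by positivity)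
  have h2 := Gamma_le_Gamma_add_nat hν k
  have h3 : 0 < Real.Gamma (ν + k + 1) := h1.trans_le h2
  have hr : 0 ≤ r := (abs_nonneg z).trans hz
  rw [norm_div, norm_mul, norm_mul, norm_pow, norm_pow, norm_neg, norm_one, one_pow, one_mul,
    Real.norm_of_nonneg h3.le, Real.norm_natCast, Real.norm_eq_abs, ← div_div, div_eq_mul_inv]
  gcongr

theorem summable_besselClifford {ν : ℝ} (hν : 0 ≤ ν) (z : ℝ) :
    Summable fun k : ℕ ↦
      (-1 : ℝ) ^ k * z ^ k / ((k.factorial : ℝ) * Real.Gamma (ν + k + 1)) :=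
  Summable.of_norm_bounded ((Real.summable_pow_div_factorial |z|).mul_right _)
    (besselClifford_term_norm_le hν le_rfl)

theorem hasDerivAt_besselClifford {ν : ℝ} (hν : 0 ≤ ν) (z : ℝ) :
    HasDerivAt (besselClifford ν) (-besselClifford (ν + 1) z) z := by
  set g' : ℕ → ℝ → ℝ := fun k z ↦
    (-1 : ℝ) ^ k * (k * z ^ (k - 1)) / ((k.factorial : ℝ) * Real.Gamma (ν + k + 1)) with hg'
  have hshift : ∀ (k : ℕ) (y : ℝ), g' (k + 1) y =
      -((-1 : ℝ) ^ k * y ^ k / ((k.factorial : ℝ) * Real.Gamma (ν + 1 + k + 1))) := by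
    intro k y
    have h : ν + (k + 1 : ℕ) + 1 = ν + 1 + k + 1 := by push_cast; ring
    have h3 : Real.Gamma (ν + 1 + k + 1) ≠ 0 := (Real.Gamma_pos_of_pos (by positivity)).ne'
    simp only [hg', h, Nat.factorial_succ, Nat.add_sub_cancel]
    push_cast
    field_simp
    ring
  have h0 : ∀ y, g' 0 y = 0 := fun y ↦ by simp [hg']
  set r := |z| + 1
  have hzr : |z| < r := lt_add_one _
  obtain ⟨u, hu, hub⟩ : ∃ u : ℕ → ℝ, Summable u ∧
      ∀ n, ∀ y ∈ Metric.ball (0 : ℝ) r, ‖g' n y‖ ≤ u n := by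
    refine ⟨fun n ↦ Nat.casesOn n 0 fun k ↦ r ^ k / k.factorial * (Real.Gamma (ν + 1 + 1))⁻¹,
      ?_, ?_⟩
    · rw [← summable_nat_add_iff 1]
      exact (Real.summable_pow_div_factorial r).mul_right _
    · intro n y hy
      rw [mem_ball_zero_iff, Real.norm_eq_abs] at hy
      cases n with
      | zero => simp [h0]
      | succ k =>
        rw [hshift, norm_neg]
        exact besselClifford_term_norm_le (by positivity) hy.le k
  have hz : z ∈ Metric.ball (0 : ℝ) r := by simpa using hzr
  have hd := hasDerivAt_tsum_of_isPreconnected (𝕜 := ℝ)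
    (g := fun (k : ℕ) y ↦ (-1 : ℝ) ^ k * y ^ k / ((k.factorial : ℝ) * Real.Gamma (ν + k + 1)))
    (g' := g') hu Metric.isOpen_ball (convex_ball (0 : ℝ) r).isPreconnected
    (fun n y _ ↦ ((hasDerivAt_pow n y).const_mul _).div_const _) hub hz
    (summable_besselClifford hν z) hz
  refine HasDerivAt.congr_deriv hd ?_
  have hs : Summable fun n ↦ g' n z := Summable.of_norm_bounded hu fun n ↦ hub n z hz
  rw [hs.tsum_eq_zero_add, h0, zero_add, besselClifford, ← tsum_neg]
  exact tsum_congr fun k ↦ hshift k z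

theorem besselClifford_recurrence {ν : ℝ} (hν : 0 ≤ ν) (z : ℝ) :
    besselClifford ν z =
      (ν + 1) * besselClifford (ν + 1) z - z * besselClifford (ν + 2) z := by
  have s1 := (summable_besselClifford (ν := ν + 1) (by positivity) z).mul_left (ν + 1)
  have s0 := summable_besselClifford hν z
  have key : ∀ k : ℕ, (-1 : ℝ) ^ (k + 1) * z ^ (k + 1) /
        (((k + 1).factorial : ℝ) * Real.Gamma (ν + (k + 1 : ℕ) + 1)) -
      (ν + 1) * ((-1 : ℝ) ^ (k + 1) * z ^ (k + 1) /
        (((k + 1).factorial : ℝ) * Real.Gamma (ν + 1 + (k + 1 : ℕ) + 1))) =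
      -(z * ((-1 : ℝ) ^ k * z ^ k / ((k.factorial : ℝ) * Real.Gamma (ν + 2 + k + 1)))) := by
    intro k
    have h3 : Real.Gamma (ν + k + 2) ≠ 0 := (Real.Gamma_pos_of_pos (by positivity)).ne'
    have e1 : ν + (k + 1 : ℕ) + 1 = ν + k + 2 := by push_cast; ring
    have e2 : ν + 1 + (k + 1 : ℕ) + 1 = ν + k + 2 + 1 := by push_cast; ring
    have e3 : ν + 2 + k + 1 = ν + k + 2 + 1 := by ring
    have h4 : ν + k + 2 ≠ 0 := by positivity
    rw [e1, e2, e3, Real.Gamma_add_one h4, Nat.factorial_succ]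
    push_cast
    field_simp
    ring
  have h : besselClifford ν z - (ν + 1) * besselClifford (ν + 1) z =
      -(z * besselClifford (ν + 2) z) := by
    have e0 : (-1 : ℝ) ^ 0 * z ^ 0 / (((0 : ℕ).factorial : ℝ) * Real.Gamma (ν + (0 : ℕ) + 1)) -
        (ν + 1) * ((-1 : ℝ) ^ 0 * z ^ 0 /
          (((0 : ℕ).factorial : ℝ) * Real.Gamma (ν + 1 + (0 : ℕ) + 1))) = 0 := by
      have h4 : ν + 1 ≠ 0 := by positivity
      have h3 : Real.Gamma (ν + 1) ≠ 0 := (Real.Gamma_pos_of_pos (by positivity)).ne'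
      simp only [Nat.cast_zero, add_zero, Real.Gamma_add_one h4]
      field_simp
      simp
    unfold besselClifford
    rw [← tsum_mul_left, ← s0.tsum_sub s1, (s0.sub s1).tsum_eq_zero_add, e0, zero_add,
      tsum_congr key, tsum_neg, tsum_mul_left]
  linarith

theorem continuous_besselClifford {ν : ℝ} (hν : 0 ≤ ν) : Continuous (besselClifford ν) :=
  continuous_iff_continuousAt.2 fun z ↦ (hasDerivAt_besselClifford hν z).continuousAt

/-- A Sonine-type energy of `z ↦ z ^ (ν / 2 + 1 / 4) * besselClifford ν z`, nonincreasing for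
large `z`. -/
noncomputable def besselCliffordEnergy (ν z : ℝ) : ℝ :=
  z ^ (ν + 1 / 2) * (besselClifford ν z ^ 2 +
    ((ν / 2 + 1 / 4) * besselClifford ν z - z * besselClifford (ν + 1) z) ^ 2 /
      (z - (ν ^ 2 - 1 / 4) / 4))

theorem hasDerivAt_besselCliffordEnergy {ν z : ℝ} (hν : 1 / 2 ≤ ν)
    (hz : (ν ^ 2 - 1 / 4) / 4 < z) :
    HasDerivAt (besselCliffordEnergy ν)
      (-(z ^ (ν + 1 / 2) * ((ν ^ 2 - 1 / 4) / 4) *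
        ((ν / 2 + 1 / 4) * besselClifford ν z - z * besselClifford (ν + 1) z) ^ 2 /
          (z * (z - (ν ^ 2 - 1 / 4) / 4) ^ 2))) z := by
  have hz0 : 0 < z := lt_of_le_of_lt (by nlinarith) hz
  have hzd : z - (ν ^ 2 - 1 / 4) / 4 ≠ 0 := (sub_pos.2 hz).ne'
  have hK := hasDerivAt_besselClifford (ν := ν) (by linarith) z
  have hK1 := hasDerivAt_besselClifford (ν := ν + 1) (by linarith) z
  have hrec := besselClifford_recurrence (ν := ν) (by linarith) z
  have hpow := Real.hasDerivAt_rpow_const (x := z) (p := ν + 1 / 2) (Or.inl hz0.ne')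
  have hW := (hK.const_mul (ν / 2 + 1 / 4)).sub ((hasDerivAt_id z).mul hK1)
  have hden := (hasDerivAt_id z).sub_const ((ν ^ 2 - 1 / 4) / 4)
  have hF := hpow.mul ((hK.pow 2).add ((hW.pow 2).div hden hzd))
  refine HasDerivAt.congr_deriv hF ?_
  rw [show ν + 1 + 1 = ν + 2 by ring]
  have hK2 : besselClifford (ν + 2) z =
      ((ν + 1) * besselClifford (ν + 1) z - besselClifford ν z) / z := by
    field_simp; linarith
  rw [hK2, Real.rpow_sub_one hz0.ne']
  simp only [Pi.sub_apply, Pi.mul_apply, Pi.add_apply, Pi.div_apply, Pi.pow_apply, id]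
  generalize besselClifford ν z = a
  generalize besselClifford (ν + 1) z = b
  generalize z ^ (ν + 1 / 2) = c
  set e := z - (ν ^ 2 - 1 / 4) / 4 with he
  have hz' : z = e + (ν ^ 2 - 1 / 4) / 4 := by rw [he]; ring
  field_simp
  rw [hz']
  ring

theorem exists_abs_besselClifford_le {ν : ℝ} (hν : 1 / 2 ≤ ν) :
    ∃ C : ℝ, 0 ≤ C ∧ ∀ z : ℝ, 0 ≤ z →
      |besselClifford ν z| ≤ C * (1 + z) ^ (-(ν / 2 + 1 / 4)) := by
  set d := (ν ^ 2 - 1 / 4) / 4 with hd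
  have hd0 : 0 ≤ d := by rw [hd]; nlinarith
  have hcont : ContinuousOn (fun z ↦ |besselClifford ν z| * (1 + z) ^ (ν / 2 + 1 / 4))
      (Icc 0 (d + 1)) := by
    refine (continuous_besselClifford (by linarith)).abs.continuousOn.mul ?_
    exact ContinuousOn.rpow_const (by fun_prop) fun x hx ↦ Or.inl (by linarith [hx.1])
  obtain ⟨C₁, hC₁⟩ := isCompact_Icc.exists_bound_of_continuousOn hcont
  have hanti : AntitoneOn (besselCliffordEnergy ν) (Ici (d + 1)) := by
    have hder : ∀ z, d + 1 ≤ z → _ := fun z hz ↦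
      hasDerivAt_besselCliffordEnergy hν (show (ν ^ 2 - 1 / 4) / 4 < z by rw [← hd]; linarith)
    refine antitoneOn_of_deriv_nonpos (convex_Ici _)
      (fun z hz ↦ (hder z hz).continuousAt.continuousWithinAt) ?_ ?_
    · exact fun z hz ↦ (hder z (interior_subset hz)).differentiableAt.differentiableWithinAt
    · intro z hz
      have hz' : d + 1 ≤ z := interior_subset hz
      rw [(hder z hz').deriv, ← hd]
      have : 0 ≤ z := by linarith
      have h2 : 0 ≤ z ^ (ν + 1 / 2) := by positivity
      rw [neg_nonpos]
      positivity
  set E := besselCliffordEnergy ν (d + 1)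
  set p := ν / 2 + 1 / 4 with hp
  have hp0 : 0 < p := by rw [hp]; linarith
  have hC1 : 0 ≤ C₁ := (norm_nonneg _).trans (hC₁ 0 ⟨le_rfl, by linarith⟩)
  refine ⟨max C₁ (√E * 2 ^ p), le_max_of_le_left hC1, fun z hz ↦ ?_⟩
  have hpos : 0 < (1 + z) ^ p := by positivity
  rw [Real.rpow_neg (by positivity), ← div_eq_mul_inv, le_div_iff₀ hpos]
  rcases le_total z (d + 1) with h | h
  · refine le_max_of_le_left (le_trans (le_abs_self _) (hC₁ z ⟨hz, h⟩))
  · refine le_max_of_le_right ?_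
    have hEz : besselCliffordEnergy ν z ≤ E := hanti self_mem_Ici h h
    have hz1 : 1 ≤ z := by linarith
    have hsq : (|besselClifford ν z| * z ^ p) ^ 2 ≤ E := by
      refine le_trans ?_ hEz
      rw [mul_pow, sq_abs, ← Real.rpow_natCast (z ^ p), ← Real.rpow_mul hz, besselCliffordEnergy,
        show p * (2 : ℕ) = ν + 1 / 2 by rw [hp]; push_cast; ring, mul_comm, ← hd]
      have h2 : 0 < z - d := by linarith
      gcongr
      exact le_add_of_nonneg_right (by positivity)
    have h1 : |besselClifford ν z| * z ^ p ≤ √E := Real.le_sqrt_of_sq_le hsq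
    calc |besselClifford ν z| * (1 + z) ^ p ≤ |besselClifford ν z| * (2 * z) ^ p := by
          gcongr; linarith
      _ = |besselClifford ν z| * z ^ p * 2 ^ p := by rw [Real.mul_rpow (by norm_num) hz]; ring
      _ ≤ √E * 2 ^ p := by gcongr

theorem besselJ_mul_rpow_eq {ν s t : ℝ} (hs : 0 < s) (ht : 0 ≤ t) :
    besselJ ν (2 * √(s * t)) * s ^ (-(ν / 2)) = t ^ (ν / 2) * besselClifford ν (s * t) := by
  have h1 : 2 * √(s * t) / 2 = √(s * t) := by ring
  have h2 : ∀ k : ℕ, √(s * t) ^ (2 * k) = (s * t) ^ k := fun k ↦ by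
    rw [pow_mul, Real.sq_sqrt (by positivity)]
  have h3 : √(s * t) ^ ν = s ^ (ν / 2) * t ^ (ν / 2) := by
    rw [Real.sqrt_eq_rpow, ← Real.rpow_mul (by positivity), Real.mul_rpow hs.le ht]
    ring_nf
  have h4 : s ^ (ν / 2) * s ^ (-(ν / 2)) = 1 := by
    rw [← Real.rpow_add hs, add_neg_cancel, Real.rpow_zero]
  simp only [besselJ, h1, h2, h3]
  change _ * besselClifford ν (s * t) * _ = _
  linear_combination (t ^ (ν / 2) * besselClifford ν (s * t)) * h4

section Laplace

variable {E : Type*} [NormedAddCommGroup E] [NormedSpace ℂ E]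

theorem integrableOn_rpow_mul_exp_neg_mul {b c : ℝ} (hb : -1 < b) (hc : 0 < c) :
    IntegrableOn (fun t : ℝ ↦ t ^ b * Real.exp (-(c * t))) (Ioi 0) := by
  simpa using integrableOn_rpow_mul_exp_neg_mul_rpow (p := 1) hb one_pos hc

theorem aestronglyMeasurable_cexp_smul {f : ℝ → E}
    (hf : AEStronglyMeasurable f (volume.restrict (Ioi 0))) (l : ℂ) :
    AEStronglyMeasurable (fun t : ℝ ↦ Complex.exp (-l * t) • f t) (volume.restrict (Ioi 0)) :=
  (by fun_prop : Continuous fun t : ℝ ↦ Complex.exp (-l * t)).aestronglyMeasurable.smul hf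

theorem norm_cexp_neg_mul_ofReal (l : ℂ) (t : ℝ) :
    ‖Complex.exp (-l * t)‖ = Real.exp (-(l.re * t)) := by
  simp [Complex.norm_exp]

theorem integrableOn_cexp_smul {f : ℝ → E} {C b : ℝ}
    (hf : AEStronglyMeasurable f (volume.restrict (Ioi 0)))
    (hfb : ∀ t, 0 < t → ‖f t‖ ≤ C * t ^ b) (hb : -1 < b) {l : ℂ} (hl : 0 < l.re) :
    IntegrableOn (fun t : ℝ ↦ Complex.exp (-l * t) • f t) (Ioi 0) := by
  refine Integrable.mono' ((integrableOn_rpow_mul_exp_neg_mul hb hl).const_mul C)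
    (aestronglyMeasurable_cexp_smul hf l) ?_
  refine (ae_restrict_iff' measurableSet_Ioi).2 (.of_forall fun t ht ↦ ?_)
  rw [norm_smul, norm_cexp_neg_mul_ofReal]
  calc Real.exp (-(l.re * t)) * ‖f t‖ ≤ Real.exp (-(l.re * t)) * (C * t ^ b) := by
        gcongr; exact hfb t ht
    _ = _ := by ring

theorem differentiableOn_laplace {f : ℝ → E} {C b : ℝ}
    (hf : AEStronglyMeasurable f (volume.restrict (Ioi 0)))
    (hfb : ∀ t, 0 < t → ‖f t‖ ≤ C * t ^ b) (hb : -1 < b) :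
    DifferentiableOn ℂ (fun l : ℂ ↦ ∫ t in Ioi (0 : ℝ), Complex.exp (-l * t) • f t)
      {l | 0 < l.re} := by
  intro l (hl : 0 < l.re)
  have hs : {z : ℂ | l.re / 2 < z.re} ∈ nhds l :=
    (isOpen_lt continuous_const Complex.continuous_re).mem_nhds (by simpa using hl)
  have hg : AEStronglyMeasurable (fun t : ℝ ↦ (-(t : ℂ)) • f t) (volume.restrict (Ioi 0)) :=
    (by fun_prop : Continuous fun t : ℝ ↦ -(t : ℂ)).aestronglyMeasurable.smul hf
  have := (hasDerivAt_integral_of_dominated_loc_of_deriv_le (𝕜 := ℂ)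
    (μ := volume.restrict (Ioi (0 : ℝ)))
    (F := fun l t ↦ Complex.exp (-l * t) • f t)
    (F' := fun l t ↦ Complex.exp (-l * t) • (-(t : ℂ)) • f t)
    (bound := fun t ↦ C * (t ^ (b + 1) * Real.exp (-(l.re / 2 * t)))) hs
    (.of_forall fun z ↦ aestronglyMeasurable_cexp_smul hf z)
    (integrableOn_cexp_smul hf hfb hb hl)
    (aestronglyMeasurable_cexp_smul hg l) ?_
    ((integrableOn_rpow_mul_exp_neg_mul (by linarith) (by positivity)).const_mul C) ?_).2
  · exact this.differentiableAt.differentiableWithinAt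
  · refine (ae_restrict_iff' measurableSet_Ioi).2 (.of_forall fun t (ht : 0 < t) z hz ↦ ?_)
    have hz' : l.re / 2 < z.re := hz
    rw [norm_smul, norm_smul, norm_cexp_neg_mul_ofReal, norm_neg, Complex.norm_real,
      Real.norm_of_nonneg ht.le]
    have hft := hfb t ht
    calc Real.exp (-(z.re * t)) * (t * ‖f t‖)
        ≤ Real.exp (-(l.re / 2 * t)) * (t * (C * t ^ b)) := by gcongr
      _ = _ := by rw [Real.rpow_add_one ht.ne']; ring
  · refine .of_forall fun t z _ ↦ ?_
    have h : HasDerivAt (fun z : ℂ ↦ Complex.exp (-z * t)) (Complex.exp (-z * t) * (-(t : ℂ))) z := by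
      have := ((hasDerivAt_id z).neg.mul_const (t : ℂ)).cexp
      simpa using this
    have h' := h.smul_const (f t)
    rwa [mul_smul] at h'

theorem isOpen_re_pos : IsOpen {l : ℂ | 0 < l.re} :=
  isOpen_lt continuous_const Complex.continuous_re

theorem eqOn_re_pos_of_eq_ofReal [CompleteSpace E] {F G : ℂ → E}
    (hF : DifferentiableOn ℂ F {l | 0 < l.re}) (hG : DifferentiableOn ℂ G {l | 0 < l.re})
    (h : ∀ r : ℝ, 0 < r → F r = G r) : EqOn F G {l | 0 < l.re} := by
  refine (hF.analyticOnNhd isOpen_re_pos).eqOn_of_preconnected_of_frequently_eq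
    (hG.analyticOnNhd isOpen_re_pos) (convex_halfSpace_re_gt 0).isPreconnected
    (z₀ := 1) (by simp) ?_
  have ht : Filter.Tendsto (fun r : ℝ ↦ (r : ℂ)) (nhdsWithin 1 {1}ᶜ) (nhdsWithin 1 {1}ᶜ) := by
    refine tendsto_nhdsWithin_iff.2 ⟨?_, ?_⟩
    · exact (Complex.continuous_ofReal.tendsto' 1 1 (by simp)).mono_left nhdsWithin_le_nhds
    · filter_upwards [self_mem_nhdsWithin] with r hr
      simpa using hr
  refine ht.frequently (Filter.Eventually.frequently ?_)
  filter_upwards [nhdsWithin_le_nhds (Ioi_mem_nhds (zero_lt_one (α := ℝ)))] with r hr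
  exact h r hr

theorem differentiableOn_cpow_re_pos (c : ℂ) :
    DifferentiableOn ℂ (fun l : ℂ ↦ l ^ c) {l | 0 < l.re} := fun _ hl ↦
  (differentiableAt_id.cpow_const (Or.inl hl)).differentiableWithinAt

theorem aestronglyMeasurable_ofReal_rpow (a : ℝ) :
    AEStronglyMeasurable (fun t : ℝ ↦ ((t ^ a : ℝ) : ℂ)) (volume.restrict (Ioi 0)) :=
  (Complex.measurable_ofReal.comp (measurable_id.pow_const a)).aestronglyMeasurable

theorem integral_cexp_smul_rpow {a : ℝ} (ha : -1 < a) {l : ℂ} (hl : 0 < l.re) :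
    ∫ t in Ioi (0 : ℝ), Complex.exp (-l * t) • ((t ^ a : ℝ) : ℂ) =
      l ^ (-(a : ℂ) - 1) * Real.Gamma (a + 1) := by
  refine eqOn_re_pos_of_eq_ofReal
    (F := fun l ↦ ∫ t in Ioi (0 : ℝ), Complex.exp (-l * t) • ((t ^ a : ℝ) : ℂ))
    (G := fun l ↦ l ^ (-(a : ℂ) - 1) * Real.Gamma (a + 1))
    (differentiableOn_laplace (C := 1) (b := a) (aestronglyMeasurable_ofReal_rpow a) ?_ ha)
    ((differentiableOn_cpow_re_pos _).mul_const _) ?_ hl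
  · intro t ht
    rw [Complex.norm_real, Real.norm_of_nonneg (by positivity), one_mul]
  · intro r hr
    have h := Real.integral_rpow_mul_exp_neg_mul_Ioi (a := a + 1) (r := r) (by linarith) hr
    have e : ∀ t : ℝ, Complex.exp (-(r : ℂ) * t) • ((t ^ a : ℝ) : ℂ) =
        ((t ^ (a + 1 - 1) * Real.exp (-(r * t)) : ℝ) : ℂ) := by
      intro t
      push_cast
      rw [smul_eq_mul, mul_comm, add_sub_cancel_right, neg_mul]
    simp only [e]
    rw [integral_complex_ofReal, h, one_div, Real.inv_rpow hr.le, ← Real.rpow_neg hr.le]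
    push_cast
    rw [Complex.ofReal_cpow hr.le]
    push_cast
    ring_nf

theorem integral_cexp_smul_rpow_mul_besselClifford {ν s : ℝ} (hν : 0 ≤ ν) {l : ℂ}
    (hl : 0 < l.re) :
    ∫ t in Ioi (0 : ℝ), Complex.exp (-l * t) • ((t ^ ν * besselClifford ν (s * t) : ℝ) : ℂ) =
      l ^ (-(ν : ℂ) - 1) * Complex.exp (-l⁻¹ * s) := by
  have hl0 : l ≠ 0 := fun h ↦ by simp [h] at hl
  have hG : ∀ k : ℕ, Real.Gamma (ν + k + 1) ≠ 0 :=
    fun k ↦ (Real.Gamma_pos_of_pos (by positivity)).ne'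
  set c : ℕ → ℝ := fun k ↦ (-1) ^ k * s ^ k / (k.factorial * Real.Gamma (ν + k + 1)) with hc
  set F : ℕ → ℝ → ℂ := fun k t ↦
    (c k : ℂ) * (Complex.exp (-l * t) • ((t ^ (ν + k) : ℝ) : ℂ)) with hF
  have hk : ∀ k : ℕ, -1 < ν + k := fun k ↦ by
    have : (0 : ℝ) ≤ k := k.cast_nonneg
    linarith
  have hint : ∀ k : ℕ, IntegrableOn
      (fun t : ℝ ↦ Complex.exp (-l * t) • ((t ^ (ν + k) : ℝ) : ℂ)) (Ioi 0) := fun k ↦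
    integrableOn_cexp_smul (C := 1) (aestronglyMeasurable_ofReal_rpow _)
      (fun t ht ↦ by rw [Complex.norm_real, Real.norm_of_nonneg (by positivity), one_mul]) (hk k) hl
  have hFi : ∀ k, Integrable (F k) (volume.restrict (Ioi 0)) := fun k ↦ (hint k).const_mul _
  have hFn : ∀ k, ∫ t in Ioi (0 : ℝ), ‖F k t‖ =
      (1 / l.re) ^ (ν + 1) * ((|s| / l.re) ^ k / k.factorial) := by
    intro k
    have e : ∀ t ∈ Ioi (0 : ℝ), ‖F k t‖ =
        |c k| * (t ^ (ν + k + 1 - 1) * Real.exp (-(l.re * t))) := by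
      intro t (ht : 0 < t)
      rw [hF]
      simp only
      rw [norm_mul, norm_smul, norm_cexp_neg_mul_ofReal, Complex.norm_real, Complex.norm_real,
        Real.norm_eq_abs, Real.norm_of_nonneg (by positivity : 0 ≤ t ^ (ν + k)),
        add_sub_cancel_right]
      ring
    rw [setIntegral_congr_fun measurableSet_Ioi e, integral_const_mul,
      Real.integral_rpow_mul_exp_neg_mul_Ioi (by positivity) hl, hc]
    simp only
    rw [abs_div, abs_mul, abs_pow, abs_pow, abs_neg, abs_one, abs_mul, Nat.abs_cast,
      abs_of_pos (Real.Gamma_pos_of_pos (by positivity : 0 < ν + k + 1)),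
      show ν + k + 1 = ν + 1 + k by ring, Real.rpow_add (by positivity), Real.rpow_natCast]
    have := hG k
    rw [show ν + k + 1 = ν + 1 + k by ring] at this
    field_simp
    rw [one_pow, one_mul, ← mul_pow, mul_one_div]
  have hsum : Summable fun k ↦ ∫ t in Ioi (0 : ℝ), ‖F k t‖ := by
    simp only [hFn]
    exact (Real.summable_pow_div_factorial _).mul_left _
  have h1 := hasSum_integral_of_summable_integral_norm hFi hsum
  have hFI : ∀ k, ∫ t in Ioi (0 : ℝ), F k t =
      l ^ (-(ν : ℂ) - 1) * ((-l⁻¹ * s) ^ k / k.factorial) := by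
    intro k
    have hG' : (Real.Gamma (ν + k + 1) : ℂ) ≠ 0 := by exact_mod_cast hG k
    have hp : l ^ (-((ν + k : ℝ) : ℂ) - 1) = l ^ (-(ν : ℂ) - 1) * (l⁻¹) ^ k := by
      rw [show -((ν + k : ℝ) : ℂ) - 1 = (-(ν : ℂ) - 1) - k by push_cast; ring,
        Complex.cpow_sub _ _ hl0, Complex.cpow_natCast, inv_pow, div_eq_mul_inv]
    rw [hF]
    simp only
    rw [integral_const_mul, integral_cexp_smul_rpow (hk k) hl, hp, hc, mul_pow, neg_pow]
    push_cast
    field_simp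
  have h2 : HasSum (fun k ↦ ∫ t in Ioi (0 : ℝ), F k t)
      (l ^ (-(ν : ℂ) - 1) * Complex.exp (-l⁻¹ * s)) := by
    simp only [hFI]
    rw [Complex.exp_eq_exp_ℂ]
    exact (NormedSpace.expSeries_div_hasSum_exp (-l⁻¹ * (s : ℂ))).mul_left _
  rw [h2.unique h1]
  refine setIntegral_congr_fun measurableSet_Ioi fun t (ht : 0 < t) ↦ ?_
  rw [besselClifford, ← tsum_mul_left, Complex.ofReal_tsum, ← tsum_const_smul'']
  refine tsum_congr fun k ↦ ?_
  rw [hF, hc]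
  simp only [smul_eq_mul]
  rw [Real.rpow_add ht, Real.rpow_natCast]
  push_cast
  ring

end Laplace

section Resolvent

variable {X : Type*} [NormedAddCommGroup X] [NormedSpace ℂ X]

theorem IsResolventOf.of_isInverseOf {A B : X →ₗ.[ℂ] X} (hB : IsInverseOf B A) {z : ℂ}
    (hz : z ≠ 0) {R : X →L[ℂ] X} (hR : IsResolventOf A z⁻¹ R) :
    IsResolventOf B z (z⁻¹ • (ContinuousLinearMap.id ℂ X - z⁻¹ • R)) := by
  have hx : ∀ x, ∃ h : (z⁻¹ • (ContinuousLinearMap.id ℂ X - z⁻¹ • R)) x ∈ B.domain,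
      B ⟨_, h⟩ = -(z⁻¹ • R x) := by
    intro x
    obtain ⟨h, h'⟩ := hB.1 ⟨R x, hR.mem x⟩
    have e : (z⁻¹ • (ContinuousLinearMap.id ℂ X - z⁻¹ • R)) x =
        -z⁻¹ • A ⟨R x, hR.mem x⟩ := by
      have := hR.right x
      simp only [smul_apply, sub_apply,
        ContinuousLinearMap.id_apply]
      nth_rewrite 1 [← this]
      module
    have hm : (z⁻¹ • (ContinuousLinearMap.id ℂ X - z⁻¹ • R)) x ∈ B.domain := by
      rw [e]; exact B.domain.smul_mem _ h
    refine ⟨hm, ?_⟩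
    have : (⟨_, hm⟩ : B.domain) = -z⁻¹ • ⟨_, h⟩ := Subtype.ext e
    rw [this, B.map_smul, h', neg_smul]
  refine ⟨fun x ↦ (hx x).1, fun x ↦ ?_, fun y ↦ ?_⟩
  · rw [(hx x).2]
    simp only [smul_apply, sub_apply,
      ContinuousLinearMap.id_apply, smul_inv_smul₀ hz]
    module
  · obtain ⟨h, h'⟩ := hB.2 y
    have h2 := hR.left ⟨B y, h⟩
    simp only [h'] at h2
    have h3 : R (z • (y : X) - B y) = -z • B y := by
      conv_rhs => rw [← h2, ← map_smul]
      congr 1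
      rw [smul_sub, smul_smul, neg_mul, mul_inv_cancel₀ hz]
      module
    simp only [smul_apply, sub_apply,
      ContinuousLinearMap.id_apply, h3]
    rw [smul_sub, smul_sub, smul_smul, smul_smul, smul_smul, inv_mul_cancel₀ hz, mul_neg,
      mul_assoc, inv_mul_cancel₀ hz]
    module

theorem isResolventOf_of_eq_ofReal [CompleteSpace X] {A : X →ₗ.[ℂ] X} {α : ℂ}
    {R : ℂ → X →L[ℂ] X}
    (hd : ∀ x, DifferentiableOn ℂ (fun l ↦ R l x) {l | 0 < l.re})
    (hR : ∀ r : ℝ, 0 < r → IsResolventOf A ((r : ℂ) ^ α) (R r)) {l : ℂ} (hl : 0 < l.re) :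
    IsResolventOf A (l ^ α) (R l) := by
  have h1 : IsResolventOf A 1 (R 1) := by simpa using hR 1 one_pos
  have key : ∀ x, R l x = R 1 (x + (1 - l ^ α) • R l x) := by
    intro x
    refine eqOn_re_pos_of_eq_ofReal (F := fun l ↦ R l x)
      (G := fun l ↦ R 1 (x + (1 - l ^ α) • R l x)) (hd x) ?_ ?_ hl
    · exact (R 1).differentiable.comp_differentiableOn
        ((((differentiableOn_cpow_re_pos α).const_sub 1).smul (hd x)).const_add x)
    · intro r hr
      have hr' := hR r hr
      have := h1.left ⟨R r x, hr'.mem x⟩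
      refine Eq.trans this.symm ?_
      congr 1
      have h2 := hr'.right x
      conv_rhs => enter [1]; rw [← h2]
      module
  have hm : ∀ x, R l x ∈ A.domain := fun x ↦ by rw [key x]; exact h1.mem _
  refine ⟨hm, fun x ↦ ?_, fun y ↦ ?_⟩
  · have h2 := h1.right (x + (1 - l ^ α) • R l x)
    have e : (⟨R l x, hm x⟩ : A.domain) = ⟨_, h1.mem (x + (1 - l ^ α) • R l x)⟩ :=
      Subtype.ext (key x)
    rw [one_smul, sub_eq_iff_eq_add] at h2
    rw [e, eq_sub_of_add_eq' h2.symm, ← key x]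
    module
  · rw [map_sub, map_smul]
    refine eqOn_re_pos_of_eq_ofReal (F := fun l ↦ l ^ α • R l (y : X) - R l (A y))
      (G := fun _ ↦ (y : X))
      (((differentiableOn_cpow_re_pos α).smul (hd _)).sub (hd _)) (differentiableOn_const _) ?_ hl
    intro r hr
    simpa using (hR r hr).left y

theorem exists_clm_eq_integral_smul {S : ℝ → X →L[ℂ] X} {M β : ℝ}
    (hc : ∀ x, ContinuousOn (fun t ↦ S t x) (Ici 0))
    (hb : ∀ t, 0 ≤ t → ‖S t‖ ≤ M * t ^ β) {k : ℝ → ℂ}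
    (hk : AEStronglyMeasurable k (volume.restrict (Ioi 0)))
    (hki : IntegrableOn (fun s ↦ ‖k s‖ * s ^ β) (Ioi 0)) :
    (∀ x, IntegrableOn (fun s ↦ k s • S s x) (Ioi 0)) ∧
    (∀ x, ∫ s in Ioi (0 : ℝ), ‖k s • S s x‖ ≤
      M * (∫ s in Ioi (0 : ℝ), ‖k s‖ * s ^ β) * ‖x‖) ∧
    ∃ T : X →L[ℂ] X, ∀ x, T x = ∫ s in Ioi (0 : ℝ), k s • S s x := by
  have hbd : ∀ x, ∀ s ∈ Ioi (0 : ℝ), ‖k s • S s x‖ ≤ M * ‖x‖ * (‖k s‖ * s ^ β) := by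
    intro x s (hs : 0 < s)
    rw [norm_smul]
    calc ‖k s‖ * ‖S s x‖ ≤ ‖k s‖ * (M * s ^ β * ‖x‖) := by
          gcongr; exact (S s).le_of_opNorm_le (hb s hs.le) x
      _ = _ := by ring
  have hint : ∀ x, IntegrableOn (fun s ↦ k s • S s x) (Ioi 0) := fun x ↦
    Integrable.mono' (hki.const_mul _)
      (hk.smul (((hc x).mono Ioi_subset_Ici_self).aestronglyMeasurable measurableSet_Ioi))
      ((ae_restrict_iff' measurableSet_Ioi).2 (.of_forall (hbd x)))
  have hnorm : ∀ x, ∫ s in Ioi (0 : ℝ), ‖k s • S s x‖ ≤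
      M * (∫ s in Ioi (0 : ℝ), ‖k s‖ * s ^ β) * ‖x‖ := by
    intro x
    calc _ ≤ ∫ s in Ioi (0 : ℝ), M * ‖x‖ * (‖k s‖ * s ^ β) :=
          setIntegral_mono_on (hint x).norm (hki.const_mul _) measurableSet_Ioi (hbd x)
      _ = _ := by rw [integral_const_mul]; ring
  refine ⟨hint, hnorm, LinearMap.mkContinuous
    { toFun := fun x ↦ ∫ s in Ioi (0 : ℝ), k s • S s x
      map_add' := fun x y ↦ by
        simp only [map_add, smul_add]
        exact integral_add (hint x) (hint y)
      map_smul' := fun c x ↦ by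
        simp only [map_smul, RingHom.id_apply, smul_comm _ c]
        exact integral_smul c _ }
    (M * ∫ s in Ioi (0 : ℝ), ‖k s‖ * s ^ β)
    (fun x ↦ (norm_integral_le_integral_norm _).trans (hnorm x)), fun x ↦ rfl⟩

theorem IsTemperedROF.completeSpace {A : X →ₗ.[ℂ] X} {α β M : ℝ} {S : ℝ → X →L[ℂ] X}
    (hS : IsTemperedROF A α β S M) : CompleteSpace X := by
  by_contra hX
  obtain ⟨R, hR, h⟩ := hS.laplace 1 one_pos
  have hR0 : ∀ x, R x = 0 := by
    intro x
    have := h x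
    rw [integral, dif_neg hX] at this
    simpa using this
  have h0 : ∀ x : X, x = 0 := by
    intro x
    rw [← hR.right x]
    have : (⟨R x, hR.mem x⟩ : A.domain) = 0 := Subtype.ext (hR0 x)
    rw [this, hR0, A.map_zero]
    simp
  have : Subsingleton X := ⟨fun x y ↦ by rw [h0 x, h0 y]⟩
  exact hX inferInstance

theorem IsTemperedROF.exists_isResolventOf {A : X →ₗ.[ℂ] X} {α β M : ℝ} {S : ℝ → X →L[ℂ] X}
    (hS : IsTemperedROF A α β S M) (hβ : 0 ≤ β) {l : ℂ} (hl : 0 < l.re) :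
    ∃ R : X →L[ℂ] X, IsResolventOf A (l ^ (α : ℂ)) R ∧
      ∀ x, l ^ ((α : ℂ) - β - 1) • R x = ∫ t in Ioi (0 : ℝ), Complex.exp (-l * t) • S t x := by
  have := hS.completeSpace
  have hSm : ∀ x, AEStronglyMeasurable (fun t ↦ S t x) (volume.restrict (Ioi 0)) := fun x ↦
    ((hS.cont x).mono Ioi_subset_Ici_self).aestronglyMeasurable measurableSet_Ioi
  have hex : ∀ l : ℂ, ∃ T : X →L[ℂ] X, 0 < l.re →
      ∀ x, T x = ∫ t in Ioi (0 : ℝ), Complex.exp (-l * t) • S t x := by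
    intro l
    by_cases hl : 0 < l.re
    · have hk : AEStronglyMeasurable (fun t : ℝ ↦ Complex.exp (-l * t))
          (volume.restrict (Ioi 0)) :=
        (by fun_prop : Continuous fun t : ℝ ↦ Complex.exp (-l * t)).aestronglyMeasurable
      have hki : IntegrableOn (fun t : ℝ ↦ ‖Complex.exp (-l * t)‖ * t ^ β) (Ioi 0) := by
        simp only [norm_cexp_neg_mul_ofReal, mul_comm (Real.exp _)]
        exact integrableOn_rpow_mul_exp_neg_mul (by linarith) hl
      obtain ⟨T, hT⟩ := (exists_clm_eq_integral_smul hS.cont hS.bound hk hki).2.2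
      exact ⟨T, fun _ ↦ hT⟩
    · exact ⟨0, fun h ↦ absurd h hl⟩
  choose Φ hΦ using hex
  have hpow : ∀ z : ℂ, z ≠ 0 → z ^ ((α : ℂ) - β - 1) * z ^ ((β : ℂ) + 1 - α) = 1 := by
    intro z hz
    rw [← Complex.cpow_add _ _ hz,
      show (α : ℂ) - β - 1 + (β + 1 - α) = 0 by ring, Complex.cpow_zero]
  have hne : ∀ {z : ℂ}, 0 < z.re → z ≠ 0 := fun h h0 ↦ by simp [h0] at h
  refine ⟨l ^ ((β : ℂ) + 1 - α) • Φ l, ?_, fun x ↦ ?_⟩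
  · refine isResolventOf_of_eq_ofReal (R := fun l ↦ l ^ ((β : ℂ) + 1 - α) • Φ l) ?_ ?_ hl
    · intro x
      have hd : DifferentiableOn ℂ (fun l ↦ Φ l x) {l | 0 < l.re} := by
        refine (differentiableOn_laplace (C := M * ‖x‖) (b := β) (hSm x) (fun t ht ↦ ?_)
          (by linarith)).congr fun l hl ↦ hΦ l hl x
        have := (S t).le_of_opNorm_le (hS.bound t ht.le) x
        linarith
      exact (differentiableOn_cpow_re_pos _).smul hd
    · intro r hr
      obtain ⟨R₀, hR₀, h⟩ := hS.laplace r hr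
      have hr' : 0 < (r : ℂ).re := by simpa using hr
      have e : (r : ℂ) ^ ((β : ℂ) + 1 - α) • Φ r = R₀ := by
        ext x
        have hx : Φ r x = (r : ℂ) ^ ((α : ℂ) - β - 1) • R₀ x := by
          rw [hΦ r hr' x]
          have e1 : ((r ^ (α - β - 1) : ℝ) : ℂ) = (r : ℂ) ^ ((α : ℂ) - β - 1) := by
            rw [Complex.ofReal_cpow hr.le]; push_cast; rfl
          rw [← e1, h x]
          refine integral_congr_ae (.of_forall fun t ↦ ?_)
          simp only
          rw [← Complex.coe_smul]
          push_cast
          rw [neg_mul]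
        rw [smul_apply, hx, smul_smul, mul_comm, hpow _ (hne hr'), one_smul]
      simp only [e]
      rwa [← Complex.ofReal_cpow hr.le]
  · rw [smul_apply, smul_smul, hpow _ (hne hl), one_smul, hΦ l hl x]

end Resolvent

section InverseKernel

theorem integrableOn_rpow_mul_one_add_mul_rpow {β p c : ℝ} (hβ : 0 ≤ β) (hp : β + 1 < p)
    (hc : 0 < c) : IntegrableOn (fun s : ℝ ↦ s ^ β * (1 + s * c) ^ (-p)) (Ioi 0) := by
  have h1 : IntegrableOn (fun s : ℝ ↦ s ^ β * (1 + s) ^ (-p)) (Ioi 0) := by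
    refine Integrable.mono' (integrableOn_add_rpow_Ioi_of_lt (a := β - p) (m := 1) (c := 0)
      (by linarith) (by norm_num)) (by measurability) ?_
    refine (ae_restrict_iff' measurableSet_Ioi).2 (.of_forall fun s (hs : 0 < s) ↦ ?_)
    rw [Real.norm_of_nonneg (by positivity), sub_eq_add_neg, Real.rpow_add (by positivity),
      add_comm s 1]
    gcongr
    linarith
  have h2 : IntegrableOn (fun s : ℝ ↦ (c * s) ^ β * (1 + c * s) ^ (-p)) (Ioi 0) :=
    (integrableOn_Ioi_comp_mul_left_iff (fun s : ℝ ↦ s ^ β * (1 + s) ^ (-p)) 0 hc).2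
      (by rwa [mul_zero])
  refine IntegrableOn.congr_fun (Integrable.const_mul h2 (c ^ (-β))) (fun s (hs : 0 < s) ↦ ?_)
    measurableSet_Ioi
  rw [Real.mul_rpow hc.le hs.le, ← mul_assoc, ← mul_assoc, ← Real.rpow_add hc, neg_add_cancel,
    Real.rpow_zero, one_mul, mul_comm c s]

theorem exists_integral_abs_besselClifford_mul_rpow_le {β ν : ℝ} (hβ : 0 ≤ β)
    (hν : 2 * β + 3 / 2 < ν) :
    (∃ C : ℝ, 0 ≤ C ∧ ∀ z : ℝ, 0 ≤ z →
      |besselClifford ν z| ≤ C * (1 + z) ^ (-(ν / 2 + 1 / 4))) ∧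
    (∀ t, 0 < t → IntegrableOn (fun s ↦ |besselClifford ν (s * t)| * s ^ β) (Ioi 0)) ∧
    ∃ C : ℝ, 0 ≤ C ∧ ∀ t, 0 < t →
      ∫ s in Ioi (0 : ℝ), |besselClifford ν (s * t)| * s ^ β = C * t ^ (-β - 1) := by
  obtain ⟨C, hC0, hC⟩ := exists_abs_besselClifford_le (ν := ν) (by linarith)
  have hcont := continuous_besselClifford (ν := ν) (by linarith)
  refine ⟨⟨C, hC0, hC⟩, fun t ht ↦ ?_, ∫ s in Ioi (0 : ℝ), |besselClifford ν s| * s ^ β,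
    setIntegral_nonneg measurableSet_Ioi fun s (hs : 0 < s) ↦ by positivity, fun t ht ↦ ?_⟩
  · refine Integrable.mono' ((integrableOn_rpow_mul_one_add_mul_rpow (p := ν / 2 + 1 / 4) hβ
      (by linarith) ht).const_mul C) ?_ ?_
    · exact ((hcont.comp (continuous_mul_const t)).abs.measurable.mul
        (measurable_id.pow_const β)).aestronglyMeasurable
    · refine (ae_restrict_iff' measurableSet_Ioi).2 (.of_forall fun s (hs : 0 < s) ↦ ?_)
      rw [Real.norm_of_nonneg (by positivity)]
      calc _ ≤ C * (1 + s * t) ^ (-(ν / 2 + 1 / 4)) * s ^ β := by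
            gcongr; exact hC _ (by positivity)
        _ = _ := by ring
  · have h := integral_comp_mul_left_Ioi (fun s ↦ |besselClifford ν s| * s ^ β) 0 ht
    rw [mul_zero, smul_eq_mul] at h
    have e : ∀ s ∈ Ioi (0 : ℝ), |besselClifford ν (s * t)| * s ^ β =
        t ^ (-β) * (|besselClifford ν (t * s)| * (t * s) ^ β) := by
      intro s (hs : 0 < s)
      have : t ^ (-β) * t ^ β = 1 := by rw [← Real.rpow_add ht, neg_add_cancel, Real.rpow_zero]
      rw [Real.mul_rpow ht.le hs.le, mul_comm t s]
      linear_combination (-|besselClifford ν (s * t)| * s ^ β) * this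
    rw [setIntegral_congr_fun measurableSet_Ioi e, integral_const_mul, h,
      Real.rpow_sub_one ht.ne']
    field_simp

variable {X : Type*} [NormedAddCommGroup X] [NormedSpace ℂ X]

theorem IsTemperedROF.integrable_laplace_besselClifford {A : X →ₗ.[ℂ] X} {α β M ν : ℝ}
    {S : ℝ → X →L[ℂ] X} (hS : IsTemperedROF A α β S M) (hβ : 0 ≤ β)
    (hν : 2 * β + 3 / 2 < ν) {l : ℂ} (hl : 0 < l.re) (x : X) :
    Integrable (Function.uncurry fun t s : ℝ ↦
        (Complex.exp (-l * t) • ((t ^ ν * besselClifford ν (s * t) : ℝ) : ℂ)) • S s x)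
      ((volume.restrict (Ioi 0)).prod (volume.restrict (Ioi 0))) := by
  obtain ⟨-, hki, C, hC0, hC⟩ := exists_integral_abs_besselClifford_mul_rpow_le hβ hν
  have hcont := continuous_besselClifford (ν := ν) (by linarith)
  have hSm : AEStronglyMeasurable (fun t ↦ S t x) (volume.restrict (Ioi 0)) :=
    ((hS.cont x).mono Ioi_subset_Ici_self).aestronglyMeasurable measurableSet_Ioi
  have hker : Continuous fun q : ℝ × ℝ ↦
      Complex.exp (-l * q.1) • ((q.1 ^ ν * besselClifford ν (q.2 * q.1) : ℝ) : ℂ) := by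
    have h1 : Continuous fun q : ℝ × ℝ ↦ q.1 ^ ν :=
      continuous_fst.rpow_const fun _ ↦ Or.inr (by linarith)
    have h2 : Continuous fun q : ℝ × ℝ ↦ besselClifford ν (q.2 * q.1) := by fun_prop
    fun_prop
  have hmeas : AEStronglyMeasurable (Function.uncurry fun t s : ℝ ↦
        (Complex.exp (-l * t) • ((t ^ ν * besselClifford ν (s * t) : ℝ) : ℂ)) • S s x)
      ((volume.restrict (Ioi 0)).prod (volume.restrict (Ioi 0))) :=
    hker.aestronglyMeasurable.smul hSm.comp_snd
  have hnorm : ∀ t : ℝ, 0 < t → ∀ s : ℝ, 0 ≤ s →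
      ‖Complex.exp (-l * t) • ((t ^ ν * besselClifford ν (s * t) : ℝ) : ℂ)‖ * s ^ β =
      Real.exp (-(l.re * t)) * t ^ ν * (|besselClifford ν (s * t)| * s ^ β) := by
    intro t ht s hs
    rw [norm_smul, norm_cexp_neg_mul_ofReal, Complex.norm_real, norm_mul,
      Real.norm_of_nonneg (by positivity : 0 ≤ t ^ ν), Real.norm_eq_abs]
    ring
  have hsec : ∀ t : ℝ, 0 < t → _ := fun t ht ↦ exists_clm_eq_integral_smul hS.cont hS.bound
    (k := fun s ↦ Complex.exp (-l * t) • ((t ^ ν * besselClifford ν (s * t) : ℝ) : ℂ))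
    (hker.comp (Continuous.prodMk_right t)).aestronglyMeasurable
    (IntegrableOn.congr_fun (Integrable.const_mul (hki t ht) (Real.exp (-(l.re * t)) * t ^ ν))
      (fun s (hs : 0 < s) ↦ (hnorm t ht s hs.le).symm) measurableSet_Ioi)
  rw [integrable_prod_iff hmeas]
  refine ⟨(ae_restrict_iff' measurableSet_Ioi).2 (.of_forall fun t ht ↦ (hsec t ht).1 x), ?_⟩
  refine Integrable.mono' ((integrableOn_rpow_mul_exp_neg_mul (b := ν - β - 1) (c := l.re)
    (by linarith) hl).const_mul (M * C * ‖x‖)) hmeas.norm.integral_prod_right' ?_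
  refine (ae_restrict_iff' measurableSet_Ioi).2 (.of_forall fun t (ht : 0 < t) ↦ ?_)
  rw [Real.norm_of_nonneg (integral_nonneg fun _ ↦ norm_nonneg _)]
  refine ((hsec t ht).2.1 x).trans_eq ?_
  rw [setIntegral_congr_fun measurableSet_Ioi fun s (hs : 0 < s) ↦ hnorm t ht s hs.le,
    integral_const_mul, hC t ht, show ν - β - 1 = ν + (-β - 1) by ring, Real.rpow_add ht]
  ring

theorem IsTemperedROF.integral_laplace_besselClifford {A : X →ₗ.[ℂ] X} {α β M ν : ℝ}
    {S : ℝ → X →L[ℂ] X} (hS : IsTemperedROF A α β S M) (hβ : 0 ≤ β)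
    (hν : 2 * β + 3 / 2 < ν) {l : ℂ} (hl : 0 < l.re) (x : X) :
    IntegrableOn (fun t : ℝ ↦ Complex.exp (-l * t) • t ^ ν •
      ∫ s in Ioi (0 : ℝ), (besselClifford ν (s * t) : ℂ) • S s x) (Ioi 0) ∧
    ∫ t in Ioi (0 : ℝ), Complex.exp (-l * t) • t ^ ν •
      ∫ s in Ioi (0 : ℝ), (besselClifford ν (s * t) : ℂ) • S s x =
      l ^ (-(ν : ℂ) - 1) • ∫ s in Ioi (0 : ℝ), Complex.exp (-l⁻¹ * s) • S s x := by
  have := hS.completeSpace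
  have hint := hS.integrable_laplace_besselClifford hβ hν hl x
  have hinner : ∀ t : ℝ, (∫ s in Ioi (0 : ℝ),
      (Complex.exp (-l * t) • ((t ^ ν * besselClifford ν (s * t) : ℝ) : ℂ)) • S s x) =
      Complex.exp (-l * t) • t ^ ν •
        ∫ s in Ioi (0 : ℝ), (besselClifford ν (s * t) : ℂ) • S s x := by
    intro t
    rw [← Complex.coe_smul, smul_smul, ← integral_smul]
    refine integral_congr_ae (.of_forall fun s ↦ ?_)
    simp only
    rw [smul_smul]
    push_cast
    rw [smul_eq_mul, mul_assoc]
  have h1 := hint.integral_prod_left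
  have h2 := integral_integral_swap hint
  simp only [Function.uncurry_apply_pair, hinner] at h1 h2
  refine ⟨h1, h2.trans ?_⟩
  rw [← integral_smul]
  refine integral_congr_ae (.of_forall fun s ↦ ?_)
  simp only
  rw [integral_smul_const, integral_cexp_smul_rpow_mul_besselClifford (by linarith) hl, smul_smul]

theorem IsTemperedROF.continuousOn_integral_besselClifford {A : X →ₗ.[ℂ] X} {α β M ν : ℝ}
    {S : ℝ → X →L[ℂ] X} (hS : IsTemperedROF A α β S M) (hβ : 0 ≤ β)
    (hν : 2 * β + 3 / 2 < ν) (x : X) :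
    ContinuousOn (fun t ↦ ∫ s in Ioi (0 : ℝ), (besselClifford ν (s * t) : ℂ) • S s x)
      (Ioi 0) := by
  obtain ⟨⟨C, hC0, hC⟩, -, -⟩ := exists_integral_abs_besselClifford_mul_rpow_le hβ hν
  have hcont := continuous_besselClifford (ν := ν) (by linarith)
  have hSm : AEStronglyMeasurable (fun t ↦ S t x) (volume.restrict (Ioi 0)) :=
    ((hS.cont x).mono Ioi_subset_Ici_self).aestronglyMeasurable measurableSet_Ioi
  intro t₀ (ht₀ : 0 < t₀)
  refine ContinuousAt.continuousWithinAt ?_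
  refine continuousAt_of_dominated
    (bound := fun s ↦ C * M * ‖x‖ * (s ^ β * (1 + s * (t₀ / 2)) ^ (-(ν / 2 + 1 / 4))))
    (.of_forall fun t ↦ ?_) ?_
    ((integrableOn_rpow_mul_one_add_mul_rpow hβ (by linarith) (by positivity)).const_mul _)
    (.of_forall fun s ↦ ?_)
  · exact (by fun_prop : Continuous fun s ↦
      (besselClifford ν (s * t) : ℂ)).aestronglyMeasurable.smul hSm
  · filter_upwards [Ioi_mem_nhds (half_lt_self ht₀)] with t ht
    have ht : t₀ / 2 < t := ht
    refine (ae_restrict_iff' measurableSet_Ioi).2 (.of_forall fun s (hs : 0 < s) ↦ ?_)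
    have htpos : 0 < t := (half_pos ht₀).trans ht
    rw [norm_smul, Complex.norm_real, Real.norm_eq_abs]
    calc |besselClifford ν (s * t)| * ‖S s x‖
        ≤ (C * (1 + s * (t₀ / 2)) ^ (-(ν / 2 + 1 / 4))) * (M * s ^ β * ‖x‖) := by
          refine mul_le_mul ((hC _ (by positivity)).trans ?_)
            ((S s).le_of_opNorm_le (hS.bound s hs.le) x) (norm_nonneg _) (by positivity)
          refine mul_le_mul_of_nonneg_left (Real.rpow_le_rpow_of_nonpos (by positivity) ?_
            (by linarith)) hC0
          gcongr
      _ = _ := by ring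
  · exact (by fun_prop : Continuous fun t ↦
      (besselClifford ν (s * t) : ℂ) • S s x).continuousAt

theorem IsTemperedROF.exists_inverse_family {A : X →ₗ.[ℂ] X} {α β γ M : ℝ}
    {S : ℝ → X →L[ℂ] X} (hS : IsTemperedROF A α β S M) (hβ : 0 ≤ β) (hγ : β + 1 / 2 < γ) :
    ∃ T : ℝ → X →L[ℂ] X,
      (∀ t, 0 < t → ∀ x, T t x = (t ^ γ / Real.Gamma (γ + 1)) • x -
        t ^ (1 + β + γ) •
          ∫ s in Ioi (0 : ℝ), (besselClifford (1 + β + γ) (s * t) : ℂ) • S s x) ∧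
      (∃ M', ∀ t, 0 ≤ t → ‖T t‖ ≤ M' * t ^ γ) ∧
      ∀ x, ContinuousOn (fun t ↦ T t x) (Ici 0) := by
  have hν : 2 * β + 3 / 2 < 1 + β + γ := by linarith
  obtain ⟨-, hki, C, hC0, hC⟩ := exists_integral_abs_besselClifford_mul_rpow_le hβ hν
  have hcont := continuous_besselClifford (ν := 1 + β + γ) (by linarith)
  have hG : 0 < Real.Gamma (γ + 1) := Real.Gamma_pos_of_pos (by linarith)
  have hop : ∀ t : ℝ, 0 < t → _ := fun t ht ↦ exists_clm_eq_integral_smul hS.cont hS.bound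
    (k := fun s ↦ (besselClifford (1 + β + γ) (s * t) : ℂ))
    (by fun_prop : Continuous fun s ↦
      (besselClifford (1 + β + γ) (s * t) : ℂ)).aestronglyMeasurable
    (by simpa only [Complex.norm_real, Real.norm_eq_abs] using hki t ht)
  have hex : ∀ t : ℝ, ∃ T : X →L[ℂ] X, (t ≤ 0 → T = 0) ∧ (0 < t → ∀ x,
      T x = (t ^ γ / Real.Gamma (γ + 1)) • x - t ^ (1 + β + γ) •
        ∫ s in Ioi (0 : ℝ), (besselClifford (1 + β + γ) (s * t) : ℂ) • S s x) := by
    intro t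
    rcases le_or_gt t 0 with ht | ht
    · exact ⟨0, fun _ ↦ rfl, fun h ↦ absurd h ht.not_gt⟩
    · obtain ⟨T, hT⟩ := (hop t ht).2.2
      refine ⟨((t ^ γ / Real.Gamma (γ + 1) : ℝ) : ℂ) • ContinuousLinearMap.id ℂ X -
        ((t ^ (1 + β + γ) : ℝ) : ℂ) • T, fun h ↦ absurd ht h.not_gt, fun _ x ↦ ?_⟩
      rw [← hT x]
      simp only [sub_apply, smul_apply, ContinuousLinearMap.id_apply, Complex.coe_smul]
  choose T hT0 hT using hex
  have hTnorm : ∀ t, 0 < t → ∀ x,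
      ‖T t x‖ ≤ ((Real.Gamma (γ + 1))⁻¹ + M * C) * t ^ γ * ‖x‖ := by
    intro t ht x
    have h1 := (norm_integral_le_integral_norm _).trans ((hop t ht).2.1 x)
    simp only [Complex.norm_real, Real.norm_eq_abs, hC t ht] at h1
    have e : t ^ γ = t ^ (1 + β + γ) * t ^ (-β - 1) := by
      rw [← Real.rpow_add ht]; ring_nf
    rw [hT t ht x]
    calc _ ≤ ‖(t ^ γ / Real.Gamma (γ + 1)) • x‖ + ‖t ^ (1 + β + γ) •
          ∫ s in Ioi (0 : ℝ), (besselClifford (1 + β + γ) (s * t) : ℂ) • S s x‖ := norm_sub_le _ _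
      _ ≤ t ^ γ / Real.Gamma (γ + 1) * ‖x‖ +
          t ^ (1 + β + γ) * (M * (C * t ^ (-β - 1)) * ‖x‖) := by
        rw [norm_smul, norm_smul, Real.norm_of_nonneg (by positivity),
          Real.norm_of_nonneg (by positivity)]
        gcongr
      _ = _ := by
        linear_combination (-(M * C * ‖x‖)) * e
  have hM : 0 ≤ M := by
    have := (norm_nonneg _).trans (hS.bound 1 zero_le_one)
    simpa using this
  refine ⟨T, hT, ⟨(Real.Gamma (γ + 1))⁻¹ + M * C, fun t ht ↦ ?_⟩, fun x t ht ↦ ?_⟩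
  · rcases ht.eq_or_lt with rfl | ht
    · rw [hT0 0 le_rfl, norm_zero]; positivity
    · exact (T t).opNorm_le_bound (by positivity) (hTnorm t ht)
  · rcases (mem_Ici.1 ht).eq_or_lt with rfl | ht
    · have h0 : T 0 x = 0 := by rw [hT0 0 le_rfl, zero_apply]
      rw [ContinuousWithinAt, h0]
      have hlim : Filter.Tendsto
          (fun t : ℝ ↦ ((Real.Gamma (γ + 1))⁻¹ + M * C) * t ^ γ * ‖x‖)
          (nhdsWithin 0 (Ici 0)) (nhds 0) := by
        have : Continuous fun t : ℝ ↦ ((Real.Gamma (γ + 1))⁻¹ + M * C) * t ^ γ * ‖x‖ :=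
          (continuous_const.mul
            (continuous_id.rpow_const fun _ ↦ Or.inr (by linarith))).mul continuous_const
        refine (this.tendsto' 0 0 ?_).mono_left nhdsWithin_le_nhds
        rw [Real.zero_rpow (by linarith), mul_zero, zero_mul]
      refine squeeze_zero_norm' ?_ hlim
      filter_upwards [self_mem_nhdsWithin] with t ht
      rcases (mem_Ici.1 ht).eq_or_lt with rfl | ht
      · rw [h0, norm_zero]; positivity
      · exact hTnorm t ht x
    · have hc := hS.continuousOn_integral_besselClifford hβ hν x
      have hpow : ∀ a : ℝ, ContinuousAt (fun t : ℝ ↦ t ^ a) t := fun a ↦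
        Real.continuousAt_rpow_const t a (Or.inl ht.ne')
      have : ContinuousAt (fun t : ℝ ↦ (t ^ γ / Real.Gamma (γ + 1)) • x - t ^ (1 + β + γ) •
          ∫ s in Ioi (0 : ℝ), (besselClifford (1 + β + γ) (s * t) : ℂ) • S s x) t :=
        (((hpow γ).div_const _).smul continuousAt_const).sub
          ((hpow _).smul (hc.continuousAt (Ioi_mem_nhds ht)))
      refine (this.congr ?_).continuousWithinAt
      filter_upwards [Ioi_mem_nhds ht] with r hr
      exact (hT r hr x).symm

end InverseKernel

theorem stmt14 {X : Type*} [NormedAddCommGroup X] [NormedSpace ℂ X]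
    (A B : X →ₗ.[ℂ] X) (alpha beta gamma M : ℝ)
    (halpha0 : 0 < alpha) (halpha2 : alpha ≤ 2) (hbeta : 0 ≤ beta)
    (hgamma : beta + 1 / 2 < gamma)
    (hinj : ∀ x : A.domain, A x = 0 → (x : X) = 0) (hB : IsInverseOf B A)
    (S : ℝ → X →L[ℂ] X) (hS : IsTemperedROF A alpha beta S M) :
    ∃ T : ℝ → X →L[ℂ] X,
      (∀ t : ℝ, 0 < t → ∀ x : X,
        T t x = (t ^ gamma / Real.Gamma (gamma + 1)) • x -
          (t ^ ((1 + beta + gamma) / 2)) •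
            ∫ s in Set.Ioi (0 : ℝ),
              (besselJ (1 + beta + gamma) (2 * Real.sqrt (s * t)) *
                s ^ (-((1 + beta + gamma) / 2))) • S s x) ∧
      (∃ M' : ℝ, IsTemperedROF B alpha gamma T M') ∧
      (∀ l : ℂ, 0 < l.re → ∃ R : X →L[ℂ] X, IsResolventOf B (l ^ (alpha : ℂ)) R ∧
        ∀ x : X, l ^ ((alpha : ℂ) - gamma - 1) • R x =
          ∫ t in Set.Ioi (0 : ℝ), Complex.exp (-l * t) • T t x) := by
  have := hS.completeSpace
  obtain ⟨T, hT, ⟨M', hTb⟩, hTc⟩ := hS.exists_inverse_family hbeta hgamma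
  have hν : 2 * beta + 3 / 2 < 1 + beta + gamma := by linarith
  have hlap : ∀ l : ℂ, 0 < l.re → ∃ R : X →L[ℂ] X, IsResolventOf B (l ^ (alpha : ℂ)) R ∧
      ∀ x : X, l ^ ((alpha : ℂ) - gamma - 1) • R x =
        ∫ t in Set.Ioi (0 : ℝ), Complex.exp (-l * t) • T t x := by
    intro l hl
    have hl0 : l ≠ 0 := fun h ↦ by simp [h] at hl
    have hinv : 0 < (l⁻¹).re := by
      rw [Complex.inv_re]; exact div_pos hl (Complex.normSq_pos.2 hl0)
    have harg : l.arg ≠ Real.pi := fun h ↦ by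
      have := (Complex.arg_eq_pi_iff.1 h).1
      linarith
    obtain ⟨R, hR, hRx⟩ := hS.exists_isResolventOf hbeta hinv
    rw [Complex.inv_cpow _ _ harg] at hR
    have hla : l ^ (alpha : ℂ) ≠ 0 := by simp [Complex.cpow_eq_zero_iff, hl0]
    refine ⟨_, hR.of_isInverseOf hB hla, fun x ↦ ?_⟩
    obtain ⟨hi2, hI2⟩ := hS.integral_laplace_besselClifford hbeta hν hl x
    have hi1 : IntegrableOn (fun t : ℝ ↦
        (Complex.exp (-l * t) • ((t ^ gamma : ℝ) : ℂ)) •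
          (((Real.Gamma (gamma + 1))⁻¹ : ℝ) : ℂ) • x) (Ioi 0) :=
      (integrableOn_cexp_smul (C := 1) (aestronglyMeasurable_ofReal_rpow _)
        (fun t ht ↦ by rw [Complex.norm_real, Real.norm_of_nonneg (by positivity), one_mul])
        (by linarith) hl).smul_const _
    have hsplit : ∀ t ∈ Ioi (0 : ℝ), Complex.exp (-l * t) • T t x =
        (Complex.exp (-l * t) • ((t ^ gamma : ℝ) : ℂ)) •
          (((Real.Gamma (gamma + 1))⁻¹ : ℝ) : ℂ) • x -
        Complex.exp (-l * t) • t ^ (1 + beta + gamma) •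
          ∫ s in Ioi (0 : ℝ), (besselClifford (1 + beta + gamma) (s * t) : ℂ) • S s x := by
      intro t ht
      rw [hT t ht x, smul_sub, ← Complex.coe_smul (t ^ gamma / Real.Gamma (gamma + 1))]
      congr 1
      rw [smul_smul, smul_smul, smul_eq_mul, div_eq_mul_inv]
      push_cast
      rw [mul_assoc]
    have hG : (Real.Gamma (gamma + 1) : ℂ) ≠ 0 := by
      exact_mod_cast (Real.Gamma_pos_of_pos (by linarith : 0 < gamma + 1)).ne'
    rw [setIntegral_congr_fun measurableSet_Ioi hsplit, integral_sub hi1 hi2, hI2, ← hRx x,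
      integral_smul_const, integral_cexp_smul_rpow (by linarith) hl, smul_smul, smul_smul]
    have e1 : l ^ (-(gamma : ℂ) - 1) * Real.Gamma (gamma + 1) *
        (((Real.Gamma (gamma + 1))⁻¹ : ℝ) : ℂ) =
        l ^ ((alpha : ℂ) - gamma - 1) * (l ^ (alpha : ℂ))⁻¹ := by
      push_cast
      rw [mul_assoc, mul_inv_cancel₀ hG, mul_one, ← Complex.cpow_neg, ← Complex.cpow_add _ _ hl0]
      ring_nf
    have e2 : l ^ (-((1 + beta + gamma : ℝ) : ℂ) - 1) * l⁻¹ ^ ((alpha : ℂ) - beta - 1) =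
        l ^ ((alpha : ℂ) - gamma - 1) * (l ^ (alpha : ℂ))⁻¹ * (l ^ (alpha : ℂ))⁻¹ := by
      rw [Complex.inv_cpow _ _ harg, ← Complex.cpow_neg, ← Complex.cpow_neg,
        ← Complex.cpow_add _ _ hl0, ← Complex.cpow_add _ _ hl0, ← Complex.cpow_add _ _ hl0]
      push_cast
      ring_nf
    rw [e1, e2]
    simp only [smul_apply, sub_apply, ContinuousLinearMap.id_apply]
    module
  refine ⟨T, fun t ht x ↦ ?_, ⟨M', hTc, hTb, fun l hl ↦ ?_⟩, hlap⟩
  · rw [hT t ht x]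
    congr 1
    have e : ∀ s ∈ Ioi (0 : ℝ), (besselJ (1 + beta + gamma) (2 * Real.sqrt (s * t)) *
        s ^ (-((1 + beta + gamma) / 2))) • S s x = t ^ ((1 + beta + gamma) / 2) •
          (besselClifford (1 + beta + gamma) (s * t) : ℂ) • S s x := by
      intro s hs
      rw [besselJ_mul_rpow_eq hs ht.le, Complex.coe_smul, smul_smul]
    rw [setIntegral_congr_fun measurableSet_Ioi e, integral_smul, smul_smul,
      ← Real.rpow_add ht, add_halves]
  · obtain ⟨R, hR, hRx⟩ := hlap l (by simpa using hl)
    refine ⟨R, ?_, fun x ↦ ?_⟩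
    · rwa [Complex.ofReal_cpow hl.le]
    · rw [Complex.ofReal_cpow hl.le]
      push_cast
      rw [hRx x]
      refine integral_congr_ae (.of_forall fun t ↦ ?_)
      simp only
      rw [← Complex.coe_smul]
      push_cast
      rw [neg_mul]
end

section
/- Let 0 < α ≤ 2, β ≥ 0, and let A generate a tempered (α,β)-ROF R_{α,β}. Then for x ∈ X: x ∈ closure(D(A)) if and only if lim_{t→0⁺} R_{α,β}(t)x / t^β = x / Γ(β+1). -/
open MeasureTheory Set

variable {X : Type*} [NormedAddCommGroup X] [NormedSpace ℂ X]

open Filter Topology in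
/-- Injectivity of the Laplace transform, sampled at the positive integers. -/
theorem ae_eq_zero_of_laplace_nat_eq_zero {E : Type*} [NormedAddCommGroup E] [NormedSpace ℝ E]
    [CompleteSpace E] {F : ℝ → E}
    (hF : IntegrableOn (fun t => Real.exp (-t) • F t) (Ioi 0))
    (h : ∀ n : ℕ, ∫ t in Ioi (0 : ℝ), Real.exp (-((n + 1 : ℝ) * t)) • F t = 0) :
    ∀ᵐ t : ℝ, t ∈ Ioi (0 : ℝ) → F t = 0 := by
  set G : ℝ → E := fun t => Real.exp (-t) • F t with hG
  have hpow_int : ∀ n : ℕ, IntegrableOn (fun t => Real.exp (-t) ^ n • G t) (Ioi 0) := by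
    intro n
    refine hF.bdd_smul 1 ?_ ?_
    · fun_prop
    · filter_upwards [ae_restrict_mem measurableSet_Ioi] with t ht
      rw [norm_pow, Real.norm_eq_abs, Real.abs_exp]
      exact pow_le_one₀ (Real.exp_pos _).le
        (Real.exp_le_one_iff.2 (by simpa using (mem_Ioi.1 ht).le))
  have hpow : ∀ n : ℕ, ∫ t in Ioi (0 : ℝ), Real.exp (-t) ^ n • G t = 0 := by
    intro n
    rw [← h n]
    refine integral_congr_ae (Eventually.of_forall fun t => ?_)
    simp only [hG, smul_smul, ← Real.exp_nat_mul, ← Real.exp_add]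
    congr 2
    ring
  have hpoly_int : ∀ p : Polynomial ℝ,
      IntegrableOn (fun t => p.eval (Real.exp (-t)) • G t) (Ioi 0) := by
    intro p
    simp only [Polynomial.eval_eq_sum_range, Finset.sum_smul, mul_smul]
    exact integrable_finsetSum _ fun n _ => (hpow_int n).smul (p.coeff n)
  have hpoly : ∀ p : Polynomial ℝ, ∫ t in Ioi (0 : ℝ), p.eval (Real.exp (-t)) • G t = 0 := by
    intro p
    simp only [Polynomial.eval_eq_sum_range, Finset.sum_smul, mul_smul]
    rw [integral_finsetSum _ fun n _ => by exact (hpow_int n).smul (p.coeff n)]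
    simp only [integral_smul, hpow, smul_zero, Finset.sum_const_zero]
  have hGzero : ∀ᵐ t : ℝ, t ∈ Ioi (0 : ℝ) → G t = 0 := by
    refine isOpen_Ioi.ae_eq_zero_of_integral_contDiff_smul_eq_zero hF.locallyIntegrableOn ?_
    intro g hg hgc hgs
    have hg0 : ∀ t ≤ 0, g t = 0 := fun t ht =>
      image_eq_zero_of_notMem_tsupport fun hmem => absurd (hgs hmem) (not_lt.2 ht)
    have hgtop : ∀ᶠ t in atTop, g t = 0 := by
      have hco := hasCompactSupport_iff_eventuallyEq.1 hgc
      rw [coclosedCompact_eq_cocompact] at hco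
      exact atTop_le_cocompact hco
    have hk : ContinuousOn (fun u => g (-Real.log u)) (Icc 0 1) := by
      intro u hu
      rcases hu.1.eq_or_lt with rfl | hu0
      · have h2 : ∀ᶠ u in 𝓝[≠] (0 : ℝ), g (-Real.log u) = 0 :=
          (tendsto_neg_atBot_atTop.comp Real.tendsto_log_nhdsNE_zero).eventually hgtop
        have h3 : (fun u => g (-Real.log u)) =ᶠ[𝓝 0] fun _ => 0 := by
          rw [eventually_nhdsWithin_iff] at h2
          filter_upwards [h2] with u hu
          by_cases h0 : u = 0
          · simp [h0, hg0 0 le_rfl]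
          · exact hu h0
        exact (continuousAt_const.congr h3.symm).continuousWithinAt
      · exact (hg.continuous.continuousAt.comp
          (Real.continuousAt_log hu0.ne').neg).continuousWithinAt
    have hset : ∫ t, g t • G t = ∫ t in Ioi (0 : ℝ), g t • G t := by
      refine (setIntegral_eq_integral_of_forall_compl_eq_zero fun t ht => ?_).symm
      rw [hg0 t (not_lt.1 ht), zero_smul]
    obtain ⟨C, hC⟩ := hg.continuous.bounded_above_of_compact_support hgc
    have hgint : IntegrableOn (fun t => g t • G t) (Ioi 0) :=
      hF.bdd_smul C hg.continuous.aestronglyMeasurable (Eventually.of_forall hC)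
    rw [hset, ← norm_le_zero_iff]
    refine le_of_forall_pos_le_add fun ε hε => ?_
    set K : ℝ := ∫ t in Ioi (0 : ℝ), ‖G t‖ with hK
    have hK0 : 0 ≤ K := integral_nonneg fun _ => norm_nonneg _
    obtain ⟨p, hp⟩ := exists_polynomial_near_of_continuousOn 0 1 _ hk (ε / (K + 1)) (by positivity)
    have hsub : ∫ t in Ioi (0 : ℝ), g t • G t =
        ∫ t in Ioi (0 : ℝ), (g t • G t - p.eval (Real.exp (-t)) • G t) := by
      rw [integral_sub hgint (hpoly_int p), hpoly p, sub_zero]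
    rw [hsub, zero_add]
    calc _ ≤ ∫ t in Ioi (0 : ℝ), ε / (K + 1) * ‖G t‖ := by
          refine norm_integral_le_of_norm_le (hF.norm.const_mul _) ?_
          filter_upwards [ae_restrict_mem measurableSet_Ioi] with t ht
          rw [← sub_smul, norm_smul]
          gcongr
          have := hp (Real.exp (-t)) ⟨(Real.exp_pos _).le,
            Real.exp_le_one_iff.2 (by simpa using (mem_Ioi.1 ht).le)⟩
          rw [Real.log_exp, neg_neg, abs_sub_comm] at this
          exact this.le
      _ = ε / (K + 1) * K := by rw [integral_const_mul]
      _ ≤ ε := by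
          rw [div_mul_eq_mul_div, div_le_iff₀ (by positivity)]
          nlinarith
  filter_upwards [hGzero] with t ht h0
  simpa [hG, (Real.exp_pos _).ne'] using ht h0

theorem integrableOn_exp_neg_mul_mul_rpow {l s : ℝ} (hl : 0 < l) (hs : -1 < s) :
    IntegrableOn (fun t : ℝ => Real.exp (-(l * t)) * t ^ s) (Ioi 0) := by
  refine (integrableOn_rpow_mul_exp_neg_mul_rpow hs one_pos hl).congr_fun (fun t _ => ?_)
    measurableSet_Ioi
  simp [mul_comm]

theorem integral_exp_neg_mul_mul_rpow {l s : ℝ} (hl : 0 < l) (hs : -1 < s) :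
    ∫ t in Ioi (0 : ℝ), Real.exp (-(l * t)) * t ^ s = Real.Gamma (s + 1) * l ^ (-(s + 1)) := by
  have := Real.integral_rpow_mul_exp_neg_mul_Ioi (a := s + 1) (by linarith) hl
  rw [add_sub_cancel_right, one_div, Real.inv_rpow hl.le, ← Real.rpow_neg hl.le] at this
  rw [mul_comm, ← this]
  simp [mul_comm]

theorem integral_Ioi_eq_zero_of_not_completeSpace {E : Type*} [NormedAddCommGroup E]
    [NormedSpace ℝ E] (hE : ¬ CompleteSpace E) (f : ℝ → E) : ∫ t in Ioi (0 : ℝ), f t = 0 := by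
  simp [integral, hE]

namespace IsTemperedROF

variable {A : X →ₗ.[ℂ] X} {α β M : ℝ} {S : ℝ → X →L[ℂ] X}

theorem completeSpace_or_subsingleton (hS : IsTemperedROF A α β S M) :
    CompleteSpace X ∨ Subsingleton X := by
  refine or_iff_not_imp_left.2 fun hX => ⟨fun a b => ?_⟩
  obtain ⟨R, hR, hL⟩ := hS.laplace 1 one_pos
  have hR0 : ∀ x, R x = 0 := fun x => by
    simpa [integral_Ioi_eq_zero_of_not_completeSpace hX] using hL x
  have hzero : ∀ x : X, x = 0 := fun x => by
    have h := hR.right x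
    have h0 : (⟨R x, hR.mem x⟩ : A.domain) = 0 := Subtype.ext (hR0 x)
    rw [h0, A.map_zero, hR0 x] at h
    simpa using h.symm
  rw [hzero a, hzero b]

theorem bound_nonneg (hS : IsTemperedROF A α β S M) : 0 ≤ M := by
  simpa using (norm_nonneg _).trans (hS.bound 1 zero_le_one)

theorem norm_apply_le (hS : IsTemperedROF A α β S M) {t : ℝ} (ht : 0 ≤ t) (x : X) :
    ‖S t x‖ ≤ M * t ^ β * ‖x‖ :=
  (S t).le_of_opNorm_le (hS.bound t ht) x

theorem aestronglyMeasurable (hS : IsTemperedROF A α β S M) (x : X) :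
    AEStronglyMeasurable (fun t => S t x) (volume.restrict (Ioi 0)) :=
  ((hS.cont x).mono Ioi_subset_Ici_self).aestronglyMeasurable measurableSet_Ioi

theorem integrableOn_exp_smul (hS : IsTemperedROF A α β S M) (hβ : 0 ≤ β) {l : ℝ} (hl : 0 < l)
    (x : X) : IntegrableOn (fun t => Real.exp (-(l * t)) • S t x) (Ioi 0) := by
  have h := (integrableOn_exp_neg_mul_mul_rpow hl (s := β) (by linarith)).const_mul (M * ‖x‖)
  refine h.mono' ((by fun_prop : AEStronglyMeasurable (fun t : ℝ => Real.exp (-(l * t))) _).smul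
    (hS.aestronglyMeasurable x)) ?_
  filter_upwards [ae_restrict_mem measurableSet_Ioi] with t ht
  rw [norm_smul, Real.norm_eq_abs, Real.abs_exp]
  calc _ ≤ Real.exp (-(l * t)) * (M * t ^ β * ‖x‖) := by
        gcongr
        exact hS.norm_apply_le (le_of_lt ht) x
    _ = _ := by ring

theorem mem_closure_of_tendsto (hS : IsTemperedROF A α β S M) (hβ : 0 ≤ β) {x y : X}
    [CompleteSpace X]
    (h : Filter.Tendsto (fun t : ℝ => (t ^ β)⁻¹ • S t x) (nhdsWithin 0 (Ioi 0)) (nhds y)) :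
    Real.Gamma (β + 1) • y ∈ closure (A.domain : Set X) := by
  have hlim : Filter.Tendsto
      (fun l : ℝ => ∫ s in Ioi (0 : ℝ),
        (Real.exp (-(1 * s)) * s ^ β) • (((l⁻¹ * s) ^ β)⁻¹ • S (l⁻¹ * s) x))
      Filter.atTop (nhds (∫ s in Ioi (0 : ℝ), (Real.exp (-(1 * s)) * s ^ β) • y)) := by
    refine tendsto_integral_filter_of_dominated_convergence
      (fun s => (Real.exp (-(1 * s)) * s ^ β) * (M * ‖x‖)) ?_ ?_
      ((integrableOn_exp_neg_mul_mul_rpow one_pos (by linarith)).mul_const _) ?_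
    · filter_upwards [Filter.eventually_gt_atTop 0] with l hl
      refine ContinuousOn.aestronglyMeasurable (fun s hs => ?_) measurableSet_Ioi
      have hs : 0 < s := hs
      have hls : 0 < l⁻¹ * s := by positivity
      have hSc : ContinuousAt (fun s => S (l⁻¹ * s) x) s :=
        ContinuousAt.comp (g := fun t => S t x) (f := fun s => l⁻¹ * s)
          ((hS.cont x).continuousAt (Ici_mem_nhds hls)) (by fun_prop)
      have h1 : ContinuousAt (fun s : ℝ => s ^ β) s :=
        Real.continuousAt_rpow_const _ _ (Or.inl hs.ne')
      have h2 : ContinuousAt (fun s : ℝ => ((l⁻¹ * s) ^ β)⁻¹) s :=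
        ((by fun_prop : ContinuousAt (fun s : ℝ => l⁻¹ * s) s).rpow_const
          (Or.inl hls.ne')).inv₀ (Real.rpow_pos_of_pos hls _).ne'
      exact (((by fun_prop : ContinuousAt (fun s : ℝ => Real.exp (-(1 * s))) s).mul h1).smul
        (h2.smul hSc)).continuousWithinAt
    · filter_upwards [Filter.eventually_gt_atTop 0] with l hl
      filter_upwards [ae_restrict_mem measurableSet_Ioi] with s hs
      have hs : 0 < s := hs
      have hls : 0 < l⁻¹ * s := by positivity
      have hpos := Real.rpow_pos_of_pos hls β
      rw [norm_smul, norm_smul, Real.norm_of_nonneg (by positivity),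
        Real.norm_of_nonneg (by positivity)]
      refine mul_le_mul_of_nonneg_left ?_ (by positivity)
      rw [inv_mul_le_iff₀ hpos]
      linarith [hS.norm_apply_le hls.le x]
    · filter_upwards [ae_restrict_mem measurableSet_Ioi] with s hs
      have hs : 0 < s := hs
      refine Filter.Tendsto.const_smul (h.comp (tendsto_nhdsWithin_iff.2 ⟨?_, ?_⟩)) _
      · simpa using tendsto_inv_atTop_zero.mul_const s
      · filter_upwards [Filter.eventually_gt_atTop 0] with l hl
        exact mem_Ioi.2 (by positivity)
  rw [integral_smul_const, integral_exp_neg_mul_mul_rpow one_pos (by linarith), Real.one_rpow,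
    mul_one] at hlim
  refine _root_.mem_closure_of_tendsto hlim ?_
  filter_upwards [Filter.eventually_gt_atTop 0] with l hl
  obtain ⟨R, hR, hL⟩ := hS.laplace l hl
  have heq : ∫ s in Ioi (0 : ℝ),
      (Real.exp (-(1 * s)) * s ^ β) • (((l⁻¹ * s) ^ β)⁻¹ • S (l⁻¹ * s) x) =
      ∫ s in Ioi (0 : ℝ), l ^ β • (fun t => Real.exp (-(l * t)) • S t x) (l⁻¹ * s) := by
    refine setIntegral_congr_fun measurableSet_Ioi fun s hs => ?_
    have hs : 0 < s := hs
    have hsβ := Real.rpow_pos_of_pos hs β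
    simp only [smul_smul]
    congr 1
    rw [Real.mul_rpow (by positivity) hs.le, Real.inv_rpow hl.le, mul_inv_cancel_left₀ hl.ne']
    field_simp
  rw [heq, integral_smul,
    integral_comp_mul_left_Ioi (fun t => Real.exp (-(l * t)) • S t x) 0 (inv_pos.2 hl), mul_zero,
    ← hL x, ← Complex.coe_smul (l ^ β), ← Complex.coe_smul l⁻¹⁻¹]
  exact A.domain.smul_mem _ (A.domain.smul_mem _ (A.domain.smul_mem _ (hR.mem x)))

theorem laplace_eq_of_mem_domain (hS : IsTemperedROF A α β S M) {l : ℝ} (hl : 0 < l)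
    (x : A.domain) :
    ∫ t in Ioi (0 : ℝ), Real.exp (-(l * t)) • S t x =
      l ^ (-(β + 1)) • (x : X) +
        l ^ (-α) • ∫ t in Ioi (0 : ℝ), Real.exp (-(l * t)) • S t (A x) := by
  obtain ⟨R, hR, hL⟩ := hS.laplace l hl
  rw [← hL, ← hL]
  have h := hR.left x
  rw [map_sub, map_smul] at h
  nth_rewrite 2 [← h]
  simp only [Complex.coe_smul, smul_sub, smul_smul, ← Real.rpow_add hl]
  rw [show -(β + 1) + α = α - β - 1 by ring, show -α + (α - β - 1) = -(β + 1) by ring]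
  abel

theorem norm_sub_le_of_mem_domain [CompleteSpace X] (hS : IsTemperedROF A α β S M) (hα : 0 < α)
    (hβ : 0 ≤ β) (x : A.domain) {t : ℝ} (ht : 0 < t) :
    ‖S t x - ((Real.Gamma (β + 1))⁻¹ * t ^ β) • (x : X)‖ ≤
      M * ‖A x‖ / (α * Real.Gamma α) * (t ^ β * t ^ α) := by
  set y := A x
  have hΓ := Real.Gamma_pos_of_pos hα
  have hM := hS.bound_nonneg
  let k : ℝ → ℝ := fun s => (Real.Gamma α)⁻¹ * s ^ (α - 1)
  let J : ℝ → X := fun t => ∫ s in (0 : ℝ)..t, k s • S (t - s) y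
  let H : ℝ → X := fun t => S t x - ((Real.Gamma (β + 1))⁻¹ * t ^ β) • (x : X)
  have hk : ∀ l : ℝ, 0 < l → IntegrableOn (fun t => Real.exp (-(l * t)) * k t) (Ioi 0) := by
    intro l hl
    refine ((integrableOn_exp_neg_mul_mul_rpow hl (s := α - 1) (by linarith)).const_mul
      (Real.Gamma α)⁻¹).congr (Filter.Eventually.of_forall fun t => ?_)
    simp only [k]; ring
  have hkval : ∀ l : ℝ, 0 < l → ∫ t in Ioi (0 : ℝ), Real.exp (-(l * t)) * k t = l ^ (-α) := by
    intro l hl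
    have h := integral_exp_neg_mul_mul_rpow hl (s := α - 1) (by linarith)
    rw [sub_add_cancel] at h
    simp only [k, mul_left_comm _ (Real.Gamma α)⁻¹]
    rw [integral_const_mul, h, inv_mul_cancel_left₀ hΓ.ne']
  have hJexp : ∀ l t : ℝ, Real.exp (-(l * t)) • J t =
      ∫ s in (0 : ℝ)..t, ContinuousLinearMap.lsmul ℝ ℝ (Real.exp (-(l * s)) * k s)
        (Real.exp (-(l * (t - s))) • S (t - s) y) := by
    intro l t
    simp only [J]
    rw [← intervalIntegral.integral_smul]
    refine intervalIntegral.integral_congr fun s _ => ?_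
    simp only [ContinuousLinearMap.lsmul_apply, smul_smul]
    congr 1
    rw [mul_right_comm, ← Real.exp_add]
    congr 2
    ring
  have hJint : ∀ l : ℝ, 0 < l → IntegrableOn (fun t => Real.exp (-(l * t)) • J t) (Ioi 0) := by
    intro l hl
    have h := integrable_posConvolution (hk l hl) (hS.integrableOn_exp_smul hβ hl y)
      (ContinuousLinearMap.lsmul ℝ ℝ)
    rw [posConvolution, integrable_indicator_iff measurableSet_Ioi] at h
    simpa only [hJexp] using h
  have hJval : ∀ l : ℝ, 0 < l → ∫ t in Ioi (0 : ℝ), Real.exp (-(l * t)) • J t =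
      l ^ (-α) • ∫ t in Ioi (0 : ℝ), Real.exp (-(l * t)) • S t y := by
    intro l hl
    simp only [hJexp]
    rw [integral_posConvolution (hk l hl) (hS.integrableOn_exp_smul hβ hl y)
      (ContinuousLinearMap.lsmul ℝ ℝ), hkval l hl, ContinuousLinearMap.lsmul_apply]
  have hpint : ∀ l : ℝ, 0 < l → IntegrableOn
      (fun t => Real.exp (-(l * t)) • ((Real.Gamma (β + 1))⁻¹ * t ^ β) • (x : X)) (Ioi 0) := by
    intro l hl
    refine (((integrableOn_exp_neg_mul_mul_rpow hl (s := β) (by linarith)).const_mul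
      (Real.Gamma (β + 1))⁻¹).smul_const (x : X)).congr (Filter.Eventually.of_forall fun t => ?_)
    simp only [smul_smul]; congr 1; ring
  have hpval : ∀ l : ℝ, 0 < l → ∫ t in Ioi (0 : ℝ),
      Real.exp (-(l * t)) • ((Real.Gamma (β + 1))⁻¹ * t ^ β) • (x : X) =
        l ^ (-(β + 1)) • (x : X) := by
    intro l hl
    simp only [smul_smul, mul_left_comm _ (Real.Gamma (β + 1))⁻¹]
    rw [integral_smul_const, integral_const_mul, integral_exp_neg_mul_mul_rpow hl (by linarith),
      inv_mul_cancel_left₀ (Real.Gamma_pos_of_pos (by linarith)).ne']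
  have hHJ : ∀ᵐ t : ℝ, t ∈ Ioi (0 : ℝ) → H t - J t = 0 := by
    refine ae_eq_zero_of_laplace_nat_eq_zero ?_ fun n => ?_
    · have h := ((hS.integrableOn_exp_smul hβ one_pos (x : X)).sub (hpint 1 one_pos)).sub
        (hJint 1 one_pos)
      refine h.congr_fun (fun t _ => ?_) measurableSet_Ioi
      simp [H, smul_sub]
    · have hn : (0 : ℝ) < n + 1 := by positivity
      have h1 := hS.integrableOn_exp_smul hβ hn (x : X)
      simp only [H, smul_sub]
      rw [integral_sub (by exact h1.sub (hpint _ hn)) (hJint _ hn), integral_sub h1 (hpint _ hn),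
        hJval _ hn, hpval _ hn, hS.laplace_eq_of_mem_domain hn x]
      abel
  have hJbound : ∀ t : ℝ, 0 < t → ‖J t‖ ≤ M * ‖y‖ / (α * Real.Gamma α) * (t ^ β * t ^ α) := by
    intro t ht
    have hint : IntervalIntegrable (fun s => M * t ^ β * ‖y‖ * k s) volume 0 t :=
      ((intervalIntegral.intervalIntegrable_rpow' (by linarith)).const_mul _).const_mul _
    have hval : ∫ s in (0 : ℝ)..t, M * t ^ β * ‖y‖ * k s =
        M * ‖y‖ / (α * Real.Gamma α) * (t ^ β * t ^ α) := by
      simp only [k]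
      rw [intervalIntegral.integral_const_mul, intervalIntegral.integral_const_mul,
        integral_rpow (Or.inl (by linarith)), sub_add_cancel, Real.zero_rpow hα.ne', sub_zero]
      field_simp
    rw [← hval]
    refine intervalIntegral.norm_integral_le_of_norm_le ht.le ?_ hint
    refine Filter.Eventually.of_forall fun s hs => ?_
    have hs0 : 0 < s := hs.1
    have hts : 0 ≤ t - s := sub_nonneg.2 hs.2
    have hk0 : 0 ≤ k s := by positivity
    rw [norm_smul, Real.norm_of_nonneg hk0, mul_comm]
    gcongr
    refine (hS.norm_apply_le hts y).trans ?_
    gcongr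
    linarith
  have hpow : ∀ r : ℝ, 0 ≤ r → Continuous fun t : ℝ => t ^ r := fun r hr =>
    Real.continuous_rpow_const hr
  have hHcont : ContinuousOn H (Ioi 0) :=
    ((hS.cont x).mono Ioi_subset_Ici_self).sub
      (((hpow β hβ).const_mul _).smul continuous_const).continuousOn
  have hBcont : Continuous fun t : ℝ => M * ‖y‖ / (α * Real.Gamma α) * (t ^ β * t ^ α) :=
    ((hpow β hβ).mul (hpow α hα.le)).const_mul _
  have hmax := Measure.eqOn_open_of_ae_eq (μ := volume)
    (f := fun t => max ‖H t‖ (M * ‖y‖ / (α * Real.Gamma α) * (t ^ β * t ^ α)))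
    (g := fun t => M * ‖y‖ / (α * Real.Gamma α) * (t ^ β * t ^ α)) (U := Ioi 0)
    ((ae_restrict_iff' measurableSet_Ioi).2 <| hHJ.mono fun t h ht => by
      have hle := hJbound t ht
      rw [← sub_eq_zero.1 (h ht)] at hle
      exact max_eq_right hle)
    isOpen_Ioi (hHcont.norm.sup hBcont.continuousOn) hBcont.continuousOn
  exact max_eq_right_iff.1 (hmax ht)

theorem tendsto_of_mem_domain [CompleteSpace X] (hS : IsTemperedROF A α β S M) (hα : 0 < α)
    (hβ : 0 ≤ β) (x : A.domain) :
    Filter.Tendsto (fun t : ℝ => (t ^ β)⁻¹ • S t x) (nhdsWithin 0 (Ioi 0))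
      (nhds ((Real.Gamma (β + 1))⁻¹ • (x : X))) := by
  rw [tendsto_iff_norm_sub_tendsto_zero]
  have hlim : Filter.Tendsto (fun t : ℝ => M * ‖A x‖ / (α * Real.Gamma α) * t ^ α)
      (nhdsWithin 0 (Ioi 0)) (nhds 0) := by
    have h := ((Real.continuous_rpow_const hα.le).const_mul
      (M * ‖A x‖ / (α * Real.Gamma α))).tendsto 0
    rw [Real.zero_rpow hα.ne', mul_zero] at h
    exact h.mono_left nhdsWithin_le_nhds
  refine squeeze_zero' (Filter.Eventually.of_forall fun _ => norm_nonneg _) ?_ hlim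
  filter_upwards [self_mem_nhdsWithin] with t ht
  have htβ := Real.rpow_pos_of_pos ht β
  have heq : (t ^ β)⁻¹ • S t x - (Real.Gamma (β + 1))⁻¹ • (x : X) =
      (t ^ β)⁻¹ • (S t x - ((Real.Gamma (β + 1))⁻¹ * t ^ β) • (x : X)) := by
    rw [smul_sub, smul_smul, mul_left_comm, inv_mul_cancel₀ htβ.ne', mul_one]
  rw [heq, norm_smul, Real.norm_of_nonneg (by positivity), inv_mul_le_iff₀ htβ]
  linarith [hS.norm_sub_le_of_mem_domain hα hβ x ht]

theorem tendsto_of_mem_closure [CompleteSpace X] (hS : IsTemperedROF A α β S M) (hα : 0 < α)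
    (hβ : 0 ≤ β) {x : X} (hx : x ∈ closure (A.domain : Set X)) :
    Filter.Tendsto (fun t : ℝ => (t ^ β)⁻¹ • S t x) (nhdsWithin 0 (Ioi 0))
      (nhds ((Real.Gamma (β + 1))⁻¹ • x)) := by
  have hΓ := Real.Gamma_pos_of_pos (show 0 < β + 1 by linarith)
  have hM := hS.bound_nonneg
  set K : ℝ := M + (Real.Gamma (β + 1))⁻¹ + 1 with hK
  have hKpos : 0 < K := by positivity
  rw [Metric.tendsto_nhds]
  intro ε hε
  obtain ⟨z, hz, hxz⟩ := Metric.mem_closure_iff.1 hx (ε / 2 / K) (by positivity)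
  filter_upwards [Metric.tendsto_nhds.1 (hS.tendsto_of_mem_domain hα hβ ⟨z, hz⟩) (ε / 2)
    (by positivity), self_mem_nhdsWithin] with t hzt ht
  have htβ := Real.rpow_pos_of_pos ht β
  rw [dist_eq_norm] at hzt hxz ⊢
  have heq : (t ^ β)⁻¹ • S t x - (Real.Gamma (β + 1))⁻¹ • x =
      (t ^ β)⁻¹ • S t (x - z) - (Real.Gamma (β + 1))⁻¹ • (x - z) +
        ((t ^ β)⁻¹ • S t z - (Real.Gamma (β + 1))⁻¹ • z) := by
    rw [map_sub, smul_sub, smul_sub]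
    abel
  have h1 : ‖(t ^ β)⁻¹ • S t (x - z)‖ ≤ M * ‖x - z‖ := by
    rw [norm_smul, Real.norm_of_nonneg (by positivity), inv_mul_le_iff₀ htβ]
    linarith [hS.norm_apply_le (le_of_lt ht) (x - z)]
  have h2 : ‖(Real.Gamma (β + 1))⁻¹ • (x - z)‖ = (Real.Gamma (β + 1))⁻¹ * ‖x - z‖ := by
    rw [norm_smul, Real.norm_of_nonneg (by positivity)]
  have h3 : K * ‖x - z‖ < ε / 2 := by
    rw [mul_comm]
    exact (lt_div_iff₀ hKpos).1 hxz
  have h4 := norm_sub_le ((t ^ β)⁻¹ • S t (x - z)) ((Real.Gamma (β + 1))⁻¹ • (x - z))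
  have h5 : K * ‖x - z‖ = M * ‖x - z‖ + (Real.Gamma (β + 1))⁻¹ * ‖x - z‖ + ‖x - z‖ := by
    rw [hK]; ring
  rw [heq]
  refine (norm_add_le _ _).trans_lt ?_
  linarith [norm_nonneg (x - z)]

end IsTemperedROF

theorem stmt15 {X : Type*} [NormedAddCommGroup X] [NormedSpace ℂ X]
    (A : X →ₗ.[ℂ] X) (alpha beta M : ℝ) (halpha0 : 0 < alpha) (halpha2 : alpha ≤ 2)
    (hbeta : 0 ≤ beta)
    (S : ℝ → X →L[ℂ] X) (hS : IsTemperedROF A alpha beta S M) :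
    ∀ x : X, x ∈ closure (A.domain : Set X) ↔
      Filter.Tendsto (fun t : ℝ => (t ^ beta)⁻¹ • S t x)
        (nhdsWithin 0 (Set.Ioi 0)) (nhds ((Real.Gamma (beta + 1))⁻¹ • x)) := by
  intro x
  rcases hS.completeSpace_or_subsingleton with hX | hX
  · refine ⟨fun hx => hS.tendsto_of_mem_closure halpha0 hbeta hx, fun h => ?_⟩
    have hmem := hS.mem_closure_of_tendsto hbeta h
    rwa [smul_inv_smul₀ (Real.Gamma_pos_of_pos (by linarith)).ne'] at hmem
  · refine iff_of_true (subset_closure ?_) ?_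
    · rw [Subsingleton.elim x 0]
      exact A.domain.zero_mem
    · convert! tendsto_const_nhds
end
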